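/- arXiv:2304.00107 — 3 statements merged into one kernel-verified Lean document; each statement's English description precedes it below -/
import Mathlib

section
/- Let M, T ≥ 1 be integers, E > 0, δ ∈ (0,1), and A ∈ K(2M). With probability at least 1 − δ over training sets S = (x^(1),…,x^(T)) drawn i.i.d. from the uniform probability measure σ_E on the sphere of radius √(2E) centered at the origin in ℝ^{2M}, every B ∈ K(2M) (in particular any empirical-risk minimizer) satisfies |C₁(B) − Ĉ_S(B)| < √( 32·E·M²·ln(6√T)/T + 32·E·ln(2/δ)/T ) + 2√(E/T), where Ĉ_S(B) = (1/T) Σ_{j=1}^T (1 − exp(−½‖(A−B)x^(j)‖²)). -/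
open MeasureTheory Matrix

noncomputable section

/-- Standard symplectic form Ω = [[0, I], [−I, 0]] on ℝ^{2M}. -/
def Omg (M : ℕ) : Matrix (Fin (2*M)) (Fin (2*M)) ℝ :=
  Matrix.reindex (finSumFinEquiv.trans (finCongr (two_mul M).symm))
                 (finSumFinEquiv.trans (finCongr (two_mul M).symm))
                 (Matrix.fromBlocks 0 1 (-1) 0)

/-- K(2M) = O(2M) ∩ Sp(2M,ℝ). -/
def KK (M : ℕ) : Set (Matrix (Fin (2*M)) (Fin (2*M)) ℝ) :=
  {A | Aᵀ * A = 1 ∧ Aᵀ * Omg M * A = Omg M}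

/-- ℓ² → ℓ² operator norm of a real matrix. -/
def opN {n : ℕ} (A : Matrix (Fin n) (Fin n) ℝ) : ℝ :=
  ‖Matrix.toEuclideanCLM (𝕜 := ℝ) A‖

/-- Action of a matrix on a Euclidean vector. -/
def mv {n : ℕ} (A : Matrix (Fin n) (Fin n) ℝ) (x : EuclideanSpace ℝ (Fin n)) :
    EuclideanSpace ℝ (Fin n) := Matrix.toEuclideanCLM (𝕜 := ℝ) A x

/-- Projection P_j : ℝ^{2MT} → ℝ^{2M} onto coordinates 2M(j−1)+1, …, 2Mj. -/
def proj (M T : ℕ) (j : Fin T) (x : EuclideanSpace ℝ (Fin (2*M*T))) :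
    EuclideanSpace ℝ (Fin (2*M)) :=
  (WithLp.equiv 2 (Fin (2*M) → ℝ)).symm (fun i =>
    x ⟨2*M*(j : ℕ) + (i : ℕ), by
      have hj : (j : ℕ) + 1 ≤ T := j.isLt
      have hi : (i : ℕ) < 2*M := i.isLt
      calc 2*M*(j : ℕ) + (i : ℕ) < 2*M*((j : ℕ)+1) := by nlinarith
        _ ≤ 2*M*T := Nat.mul_le_mul_left _ hj⟩)

lemma abs_exp_neg_half_sq_sub_le (r s : ℝ) :
    |Real.exp (-(1/2) * r^2) - Real.exp (-(1/2) * s^2)| ≤ Real.sqrt (1/2) * |r - s| := by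
  have hd : ∀ x : ℝ, HasDerivAt (fun x : ℝ => Real.exp (-(1/2) * x^2))
      (Real.exp (-(1/2) * x^2) * (-x)) x := by
    intro x
    have h := ((hasDerivAt_pow 2 x).const_mul (-(1/2) : ℝ)).exp
    convert h using 1
    push_cast
    ring
  have hb : ∀ x : ℝ, ‖Real.exp (-(1/2) * x^2) * (-x)‖ ≤ Real.sqrt (1/2) := by
    intro x
    rw [Real.norm_eq_abs]
    apply Real.abs_le_sqrt
    have h1 := Real.mul_exp_neg_le_exp_neg_one (x^2)
    have h2 : Real.exp (-1) ≤ 1/2 := by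
      rw [Real.exp_neg, one_div]
      exact inv_anti₀ (by norm_num) (by linarith [Real.add_one_le_exp (1 : ℝ)])
    have h3 : (Real.exp (-(1/2) * x^2) * (-x))^2 = x^2 * Real.exp (-(x^2)) := by
      rw [mul_pow, ← Real.exp_nat_mul]
      push_cast
      ring_nf
    rw [h3]
    linarith
  have := Convex.norm_image_sub_le_of_norm_hasDerivWithin_le
    (s := Set.univ) (fun x _ => (hd x).hasDerivWithinAt) (fun x _ => hb x) convex_univ
    (Set.mem_univ s) (Set.mem_univ r)
  simpa [Real.norm_eq_abs] using this

/-- Volume bound for separated subsets of the unit ball. -/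
lemma card_le_of_separated_in_closedBall {V : Type*} [NormedAddCommGroup V] [NormedSpace ℝ V]
    [FiniteDimensional ℝ V] {r : ℝ} (hr : 0 < r) (s : Finset V) (hs : ∀ c ∈ s, ‖c‖ ≤ 1)
    (h : ∀ c ∈ s, ∀ d ∈ s, c ≠ d → r ≤ ‖c - d‖) :
    (s.card : ℝ) ≤ (1 + 2 / r) ^ Module.finrank ℝ V := by
  borelize V
  let μ : Measure V := Measure.addHaar
  have hδ : 0 < r / 2 := by positivity
  have hρ : 0 < 1 + r / 2 := by positivity
  have hD : Set.Pairwise (s : Set V)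
      (Function.onFun Disjoint fun c => Metric.ball (c : V) (r / 2)) := by
    rintro c hc d hd hcd
    apply Metric.ball_disjoint_ball
    rw [dist_eq_norm, add_halves]
    exact h c hc d hd hcd
  have hsub : (⋃ c ∈ s, Metric.ball (c : V) (r / 2)) ⊆ Metric.ball (0 : V) (1 + r / 2) := by
    refine Set.iUnion₂_subset fun x hx => Metric.ball_subset_ball' ?_
    rw [dist_zero_right, add_comm]
    gcongr
    exact hs x hx
  have hI : (s.card : ENNReal) * ENNReal.ofReal ((r / 2) ^ Module.finrank ℝ V)
        * μ (Metric.ball 0 1) ≤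
      ENNReal.ofReal ((1 + r / 2) ^ Module.finrank ℝ V) * μ (Metric.ball 0 1) :=
    calc
      _ = μ (⋃ c ∈ s, Metric.ball (c : V) (r / 2)) := by
        rw [measure_biUnion_finset hD fun c _ => measurableSet_ball]
        simp only [μ.addHaar_ball_of_pos _ hδ, Finset.sum_const, nsmul_eq_mul, mul_assoc]
      _ ≤ μ (Metric.ball (0 : V) (1 + r / 2)) := measure_mono hsub
      _ = _ := by simp only [μ.addHaar_ball_of_pos _ hρ]
  have hJ := (ENNReal.mul_le_mul_iff_left
    (Metric.measure_ball_pos μ _ zero_lt_one).ne' measure_ball_lt_top.ne).1 hI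
  have hK := ENNReal.toReal_le_of_le_ofReal (pow_nonneg hρ.le _) hJ
  rw [ENNReal.toReal_mul, ENNReal.toReal_natCast,
    ENNReal.toReal_ofReal (by positivity), ← le_div_iff₀ (by positivity), ← div_pow] at hK
  have hratio : 1 + 2 / r = (1 + r / 2) / (r / 2) := by
    field_simp
    ring
  rwa [hratio]

/-- A subset of the unit ball has an internal `r`-net of at most `(1 + 2 / r) ^ dim` points. -/
lemma exists_finset_net {V : Type*} [NormedAddCommGroup V] [NormedSpace ℝ V]
    [FiniteDimensional ℝ V] {r : ℝ} (hr : 0 < r) (K : Set V) (hK : ∀ c ∈ K, ‖c‖ ≤ 1) :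
    ∃ s : Finset V, (∀ c ∈ s, c ∈ K) ∧ (∀ x ∈ K, ∃ c ∈ s, ‖x - c‖ ≤ r) ∧
      (s.card : ℝ) ≤ (1 + 2 / r) ^ Module.finrank ℝ V := by
  classical
  let P : ℕ → Prop := fun n => ∃ s : Finset V, (∀ c ∈ s, c ∈ K) ∧
    (∀ c ∈ s, ∀ d ∈ s, c ≠ d → r ≤ ‖c - d‖) ∧ s.card = n
  have hP0 : P 0 := ⟨∅, by simp, by simp, rfl⟩
  have hbound : ∀ n, P n → n ≤ ⌊(1 + 2 / r) ^ Module.finrank ℝ V⌋₊ := by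
    rintro n ⟨s, hsK, hsep, rfl⟩
    exact Nat.le_floor (card_le_of_separated_in_closedBall hr s (fun c hc => hK c (hsK c hc)) hsep)
  obtain ⟨s, hsK, hsep, hcard⟩ := Nat.findGreatest_spec (P := P) (Nat.zero_le _) hP0
  refine ⟨s, hsK, fun x hx => ?_,
    card_le_of_separated_in_closedBall hr s (fun c hc => hK c (hsK c hc)) hsep⟩
  by_contra! hfar
  have hxs : x ∉ s := fun hxs => by
    have := hfar x hxs
    simp only [sub_self, norm_zero] at this
    exact absurd this hr.not_gt
  have hP : P (insert x s).card := by
    refine ⟨insert x s, ?_, ?_, rfl⟩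
    · intro c hc
      rcases Finset.mem_insert.1 hc with rfl | hc
      exacts [hx, hsK c hc]
    · intro c hc d hd hcd
      rcases Finset.mem_insert.1 hc with hcx | hcs <;>
        rcases Finset.mem_insert.1 hd with hdx | hds
      · exact absurd (hcx.trans hdx.symm) hcd
      · exact hcx ▸ (hfar d hds).le
      · rw [norm_sub_rev]
        exact hdx ▸ (hfar c hcs).le
      · exact hsep c hcs d hds hcd
  have h1 := Nat.le_findGreatest (hbound _ hP) hP
  rw [← hcard, Finset.card_insert_of_notMem hxs] at h1
  omega

/-- Two-sided Hoeffding inequality for the empirical mean of a bounded function. -/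
lemma measure_pi_abs_integral_sub_mean_ge_le {Ω : Type*} [MeasurableSpace Ω] (μ : Measure Ω)
    [IsProbabilityMeasure μ] {f : Ω → ℝ} (hf : Measurable f) {c : ℝ}
    (hfc : ∀ᵐ x ∂μ, f x ∈ Set.Icc 0 c) {T : ℕ} (hT : 1 ≤ T) {t : ℝ} (ht : 0 ≤ t) :
    (Measure.pi fun _ : Fin T => μ)
        {S | t ≤ |(∫ y, f y ∂μ) - (1/(T:ℝ)) * ∑ j : Fin T, f (S j)|} ≤
      ENNReal.ofReal (2 * Real.exp (-(2 * T * t^2) / c^2)) := by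
  have hT0 : (0 : ℝ) < T := by exact_mod_cast hT
  let P := Measure.pi fun _ : Fin T => μ
  let m := ∫ y, f y ∂μ
  have hsub := ProbabilityTheory.hasSubgaussianMGF_of_mem_Icc hf.aemeasurable hfc
  have hsubj : ∀ j : Fin T, ProbabilityTheory.HasSubgaussianMGF
      (fun S : Fin T → Ω => f (S j) - m) ((‖c - 0‖₊ / 2) ^ 2) P := by
    intro j
    have hmap : P.map (Function.eval j) = μ := (measurePreserving_eval (fun _ => μ) j).map_eq
    have hsub' : ProbabilityTheory.HasSubgaussianMGF (fun x : Ω => f x - m)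
        ((‖c - 0‖₊ / 2) ^ 2) (P.map (Function.eval j)) := by rw [hmap]; exact hsub
    have heval : AEMeasurable (Function.eval j : (Fin T → Ω) → Ω) P :=
      (measurable_pi_apply j).aemeasurable
    exact hsub'.of_map heval
  have hind : ProbabilityTheory.iIndepFun (fun (j : Fin T) (S : Fin T → Ω) => f (S j) - m) P :=
    ProbabilityTheory.iIndepFun_pi (X := fun _ x => f x - m)
      fun _ => (hf.sub_const m).aemeasurable
  have hind' : ProbabilityTheory.iIndepFun (fun (j : Fin T) (S : Fin T → Ω) => -(f (S j) - m)) P :=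
    ProbabilityTheory.iIndepFun_pi (X := fun _ x => -(f x - m))
      fun _ => (hf.sub_const m).neg.aemeasurable
  have hTt : 0 ≤ T * t := by positivity
  have h1 := ProbabilityTheory.HasSubgaussianMGF.measure_sum_ge_le_of_iIndepFun hind
    (s := Finset.univ) (fun j _ => hsubj j) hTt
  have h2 := ProbabilityTheory.HasSubgaussianMGF.measure_sum_ge_le_of_iIndepFun hind'
    (s := Finset.univ) (fun j _ => (hsubj j).neg) hTt
  have hexp : -((T : ℝ) * t)^2 / (2 * ((∑ _j : Fin T, (‖c - 0‖₊ / 2) ^ 2 : NNReal) : ℝ)) =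
      -(2 * T * t^2) / c^2 := by
    simp only [sub_zero, Finset.sum_const, Finset.card_univ, Fintype.card_fin, nsmul_eq_mul,
      NNReal.coe_mul, NNReal.coe_natCast, NNReal.coe_pow, NNReal.coe_div, coe_nnnorm,
      NNReal.coe_ofNat, div_pow, Real.norm_eq_abs, sq_abs]
    rcases eq_or_ne c 0 with rfl | hc
    · simp
    · field_simp
  push_cast at h1 h2 hexp
  rw [hexp] at h1 h2
  have hincl : {S : Fin T → Ω | t ≤ |m - (1/(T:ℝ)) * ∑ j : Fin T, f (S j)|} ⊆
      {S | T * t ≤ ∑ j : Fin T, (f (S j) - m)} ∪ {S | T * t ≤ ∑ j : Fin T, -(f (S j) - m)} := by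
    intro S hS
    simp only [Set.mem_ofPred_eq, Set.mem_union, Finset.sum_neg_distrib, Finset.sum_sub_distrib,
      Finset.sum_const, Finset.card_univ, Fintype.card_fin, nsmul_eq_mul] at hS ⊢
    have hs : ∑ j : Fin T, f (S j) = T * ((1/(T:ℝ)) * ∑ j : Fin T, f (S j)) := by field_simp
    rw [hs]
    rcases le_abs.1 hS with h | h
    · right
      nlinarith
    · left
      nlinarith
  calc P {S | t ≤ |m - (1/(T:ℝ)) * ∑ j : Fin T, f (S j)|}
      ≤ P {S | T * t ≤ ∑ j : Fin T, (f (S j) - m)} +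
          P {S | T * t ≤ ∑ j : Fin T, -(f (S j) - m)} :=
        (measure_mono hincl).trans (measure_union_le _ _)
    _ ≤ ENNReal.ofReal (Real.exp (-(2 * T * t^2) / c^2)) +
          ENNReal.ofReal (Real.exp (-(2 * T * t^2) / c^2)) := by
        gcongr
        · exact (ENNReal.le_ofReal_iff_toReal_le (measure_ne_top _ _) (by positivity)).2 h1
        · exact (ENNReal.le_ofReal_iff_toReal_le (measure_ne_top _ _) (by positivity)).2 h2
    _ = _ := by rw [← ENNReal.ofReal_add (by positivity) (by positivity), ← two_mul]

lemma norm_toEuclideanCLM_apply_of_mem_KK {M : ℕ} {B : Matrix (Fin (2*M)) (Fin (2*M)) ℝ}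
    (hB : B ∈ KK M) (x : EuclideanSpace ℝ (Fin (2*M))) :
    ‖Matrix.toEuclideanCLM (𝕜 := ℝ) B x‖ = ‖x‖ := by
  have h : star B * B = 1 := hB.1
  have h2 : B * star B = 1 := mul_eq_one_comm.1 h
  have hU : B ∈ unitary (Matrix (Fin (2*M)) (Fin (2*M)) ℝ) := ⟨h, h2⟩
  have hU' : Matrix.toEuclideanCLM (𝕜 := ℝ) B ∈
      unitary (EuclideanSpace ℝ (Fin (2*M)) →L[ℝ] EuclideanSpace ℝ (Fin (2*M))) :=
    Unitary.map_mem (Matrix.toEuclideanCLM (𝕜 := ℝ) (n := Fin (2*M))) hU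
  exact ContinuousLinearMap.norm_map_of_mem_unitary hU' x

lemma finrank_euclidean_clm (n : ℕ) :
    Module.finrank ℝ (EuclideanSpace ℝ (Fin n) →L[ℝ] EuclideanSpace ℝ (Fin n)) = n * n := by
  rw [← (Matrix.toEuclideanCLM (𝕜 := ℝ) (n := Fin n)).toAlgEquiv.toLinearEquiv.finrank_eq]
  simp [Module.finrank_matrix]

/-- The net cardinality times the Hoeffding tail is at most `δ`. -/
lemma card_mul_hoeffding_tail_le {M T : ℕ} (hT : 1 ≤ T) {E δ c N : ℝ} (hE : 0 < E)
    (hδ0 : 0 < δ) (hδ1 : δ < 1) (hc0 : 0 < c) (hc : c^2 ≤ 16 * E)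
    (hN : N ≤ (1 + 2 / (1 / Real.sqrt T)) ^ ((2*M) * (2*M))) :
    N * (2 * Real.exp (-(2 * T * (Real.sqrt (32*E*M^2 * Real.log (6 * Real.sqrt T) / T
      + 32*E * Real.log (2/δ) / T))^2) / c^2)) ≤ δ := by
  have hT1 : (1 : ℝ) ≤ T := by exact_mod_cast hT
  have hT0 : (0 : ℝ) < T := by linarith
  have hs1 : 1 ≤ Real.sqrt T := Real.one_le_sqrt.2 hT1
  have hl1 : 0 ≤ Real.log (6 * Real.sqrt T) := Real.log_nonneg (by linarith)
  have hl2 : 0 ≤ Real.log (2/δ) := Real.log_nonneg (by rw [le_div_iff₀ hδ0]; linarith)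
  rw [Real.sq_sqrt (by positivity)]
  have hN' : N ≤ Real.exp (4 * M^2 * Real.log (6 * Real.sqrt T)) := by
    refine hN.trans ?_
    calc (1 + 2 / (1 / Real.sqrt T)) ^ ((2*M) * (2*M))
        ≤ (6 * Real.sqrt T) ^ ((2*M) * (2*M)) := by
          gcongr
          rw [div_div_eq_mul_div, div_one]
          linarith
      _ = Real.exp (4 * M^2 * Real.log (6 * Real.sqrt T)) := by
          have h6 : 0 < 6 * Real.sqrt T := by positivity
          conv_lhs => rw [← Real.exp_log h6, ← Real.exp_nat_mul]
          push_cast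
          ring_nf
  have hexp : -(2 * T * (32*E*M^2 * Real.log (6 * Real.sqrt T) / T
      + 32*E * Real.log (2/δ) / T)) / c^2 ≤
      -(4 * M^2 * Real.log (6 * Real.sqrt T)) - Real.log (2/δ) := by
    have hu : 0 ≤ M^2 * Real.log (6 * Real.sqrt T) + Real.log (2/δ) := by positivity
    have heq : 2 * T * (32*E*M^2 * Real.log (6 * Real.sqrt T) / T
      + 32*E * Real.log (2/δ) / T) =
        64 * E * (M^2 * Real.log (6 * Real.sqrt T) + Real.log (2/δ)) := by
      field_simp
      ring
    rw [heq, div_le_iff₀ (by positivity)]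
    have := mul_le_mul_of_nonneg_right hc hu
    nlinarith [mul_nonneg hl2 (sq_nonneg c)]
  calc _ ≤ Real.exp (4 * M^2 * Real.log (6 * Real.sqrt T)) *
        (2 * Real.exp (-(4 * M^2 * Real.log (6 * Real.sqrt T)) - Real.log (2/δ))) := by
        gcongr
    _ = 2 * Real.exp (-Real.log (2/δ)) := by
        rw [mul_left_comm, ← Real.exp_add]
        ring_nf
    _ = δ := by
        rw [Real.exp_neg, Real.exp_log (by positivity)]
        field_simp

/-- Generalization bound for ERM1: with probability at least `1 − δ` over training sets
`S = (x⁽¹⁾,…,x⁽ᵀ⁾)` drawn i.i.d. from the uniform measure `σ_E` on the sphere of radius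
`√(2E)` in `ℝ^{2M}`, every `B ∈ K(2M)` satisfies
`|C₁(B) − Ĉ_S(B)| < √(32EM² ln(6√T)/T + 32E ln(2/δ)/T) + 2√(E/T)`. -/
theorem erm1_generalization_bound (M T : ℕ) (hM : 1 ≤ M) (hT : 1 ≤ T)
    (E δ : ℝ) (hE : 0 < E) (hδ0 : 0 < δ) (hδ1 : δ < 1)
    (A : Matrix (Fin (2*M)) (Fin (2*M)) ℝ) (hA : A ∈ KK M)
    (σE : Measure (EuclideanSpace ℝ (Fin (2*M)))) [IsProbabilityMeasure σE]
    (hsupp : ∀ᵐ x ∂σE, ‖x‖ = Real.sqrt (2*E))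
    (hrot : ∀ e : EuclideanSpace ℝ (Fin (2*M)) ≃ₗᵢ[ℝ] EuclideanSpace ℝ (Fin (2*M)),
      Measure.map e σE = σE) :
    ENNReal.ofReal (1 - δ) ≤
      (Measure.pi fun _ : Fin T => σE) {S | ∀ B ∈ KK M,
        |(∫ y, (1 - Real.exp (-(1/2) * ‖mv (A - B) y‖^2)) ∂σE)
          - (1/(T:ℝ)) * ∑ j : Fin T, (1 - Real.exp (-(1/2) * ‖mv (A - B) (S j)‖^2))|
        < Real.sqrt (32*E*M^2 * Real.log (6 * Real.sqrt T) / T + 32*E * Real.log (2/δ) / T)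
          + 2 * Real.sqrt (E / T)} := by
  classical
  let Φ := Matrix.toEuclideanCLM (𝕜 := ℝ) (n := Fin (2*M))
  let f : (EuclideanSpace ℝ (Fin (2*M)) →L[ℝ] EuclideanSpace ℝ (Fin (2*M))) → EuclideanSpace ℝ (Fin (2*M)) → ℝ :=
    fun L x => 1 - Real.exp (-(1/2) * ‖(Φ A - L) x‖^2)
  let K : Set (EuclideanSpace ℝ (Fin (2*M)) →L[ℝ] EuclideanSpace ℝ (Fin (2*M))) := Φ '' KK M
  let R : (EuclideanSpace ℝ (Fin (2*M)) →L[ℝ] EuclideanSpace ℝ (Fin (2*M))) →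
      (Fin T → EuclideanSpace ℝ (Fin (2*M))) → ℝ := fun L S =>
    (∫ y, f L y ∂σE) - (1/(T:ℝ)) * ∑ j : Fin T, f L (S j)
  let t := Real.sqrt (32*E*M^2 * Real.log (6 * Real.sqrt T) / T + 32*E * Real.log (2/δ) / T)
  have hT1 : (1 : ℝ) ≤ T := by exact_mod_cast hT
  have hT0 : (0 : ℝ) < T := by linarith
  have hr : 0 < 1 / Real.sqrt T := by positivity
  have hf_mem : ∀ L x, f L x ∈ Set.Icc (0 : ℝ) 1 := fun L x =>
    ⟨sub_nonneg.2 (Real.exp_le_one_iff.2 (by nlinarith [sq_nonneg ‖(Φ A - L) x‖])),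
      by simp only [f]; linarith [Real.exp_pos (-(1/2) * ‖(Φ A - L) x‖^2)]⟩
  have hf_meas : ∀ L, Measurable (f L) := fun L =>
    Continuous.measurable (by fun_prop)
  have hf_int : ∀ L, Integrable (f L) σE := fun L =>
    Integrable.of_mem_Icc 0 1 (hf_meas L).aemeasurable (ae_of_all _ (hf_mem L))
  have hK_norm : ∀ L ∈ K, ∀ x, ‖L x‖ = ‖x‖ := by
    rintro _ ⟨B, hB, rfl⟩ x
    exact norm_toEuclideanCLM_apply_of_mem_KK hB x
  have hf_ae : ∀ L ∈ K, ∀ᵐ x ∂σE, f L x ∈ Set.Icc 0 (min 1 (4 * E)) := by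
    intro L hL
    filter_upwards [hsupp] with x hx
    refine ⟨(hf_mem L x).1, le_min (hf_mem L x).2 ?_⟩
    have h1 : ‖(Φ A - L) x‖ ≤ 2 * Real.sqrt (2*E) := by
      calc ‖(Φ A - L) x‖ ≤ ‖Φ A x‖ + ‖L x‖ := norm_sub_le _ _
        _ = 2 * Real.sqrt (2*E) := by
          rw [hK_norm L hL, hK_norm (Φ A) ⟨A, hA, rfl⟩, hx]
          ring
    have h2 : ‖(Φ A - L) x‖^2 ≤ 8 * E := by
      calc _ ≤ (2 * Real.sqrt (2*E))^2 := by gcongr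
        _ = 8 * E := by rw [mul_pow, Real.sq_sqrt (by positivity)]; ring
    have h3 := Real.add_one_le_exp (-(1/2) * ‖(Φ A - L) x‖^2)
    simp only [f]
    linarith
  have hf_lip : ∀ L L' : EuclideanSpace ℝ (Fin (2*M)) →L[ℝ] EuclideanSpace ℝ (Fin (2*M)),
      ‖L - L'‖ ≤ 1 / Real.sqrt T → ∀ x : EuclideanSpace ℝ (Fin (2*M)),
      ‖x‖ = Real.sqrt (2*E) → |f L x - f L' x| ≤ Real.sqrt (E / T) := by
    intro L L' hLL x hx
    calc |f L x - f L' x|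
        = |Real.exp (-(1/2) * ‖(Φ A - L') x‖^2) - Real.exp (-(1/2) * ‖(Φ A - L) x‖^2)| := by
          simp only [f]
          ring_nf
      _ ≤ Real.sqrt (1/2) * |‖(Φ A - L') x‖ - ‖(Φ A - L) x‖| :=
          abs_exp_neg_half_sq_sub_le _ _
      _ ≤ Real.sqrt (1/2) * ‖(L - L') x‖ := by
          gcongr
          have hsub : (L - L') x = (Φ A - L') x - (Φ A - L) x := by
            rw [← _root_.sub_apply, sub_sub_sub_cancel_left]
          rw [hsub]
          exact abs_norm_sub_norm_le _ _
      _ ≤ Real.sqrt (1/2) * (1 / Real.sqrt T * Real.sqrt (2*E)) := by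
          gcongr
          exact (L - L').le_of_opNorm_le_of_le hLL hx.le
      _ = Real.sqrt (E / T) := by
          rw [mul_left_comm, ← Real.sqrt_mul (by norm_num), Real.sqrt_div hE.le,
            one_div_mul_eq_div]
          ring_nf
  obtain ⟨s, hsK, hs_net, hs_card⟩ := exists_finset_net hr K fun L hL =>
    L.opNorm_le_bound zero_le_one fun x => by rw [hK_norm L hL, one_mul]
  rw [finrank_euclidean_clm] at hs_card
  have hc0 : 0 < min 1 (4 * E) := lt_min one_pos (by positivity)
  have hc : (min 1 (4 * E))^2 ≤ 16 * E := by
    nlinarith [min_le_left 1 (4 * E), min_le_right 1 (4 * E)]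
  have hbad : (Measure.pi fun _ : Fin T => σE) (⋃ L ∈ s, {S | t ≤ |R L S|}) ≤
      ENNReal.ofReal δ := by
    calc _ ≤ ∑ L ∈ s, (Measure.pi fun _ : Fin T => σE) {S | t ≤ |R L S|} :=
          measure_biUnion_finset_le _ _
      _ ≤ ∑ _L ∈ s, ENNReal.ofReal
            (2 * Real.exp (-(2 * T * t^2) / (min 1 (4 * E))^2)) :=
          Finset.sum_le_sum fun L hL => measure_pi_abs_integral_sub_mean_ge_le σE (hf_meas L)
            (hf_ae L (hsK L hL)) hT (Real.sqrt_nonneg _)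
      _ = ENNReal.ofReal (s.card * (2 * Real.exp (-(2 * T * t^2) / (min 1 (4 * E))^2))) := by
          rw [Finset.sum_const, nsmul_eq_mul, ENNReal.ofReal_mul (Nat.cast_nonneg _),
            ENNReal.ofReal_natCast]
      _ ≤ ENNReal.ofReal δ := ENNReal.ofReal_le_ofReal
          (card_mul_hoeffding_tail_le hT hE hδ0 hδ1 hc0 hc hs_card)
  have hsphere : (Measure.pi fun _ : Fin T => σE)
      {S | ∀ j, ‖S j‖ = Real.sqrt (2*E)}ᶜ = 0 := by
    rw [← mem_ae_iff]
    exact Filter.eventually_all.2 fun j =>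
      (measurePreserving_eval (fun _ => σE) j).quasiMeasurePreserving.ae hsupp
  have hgood : ∀ S : Fin T → EuclideanSpace ℝ (Fin (2*M)), (∀ j, ‖S j‖ = Real.sqrt (2*E)) →
      (∀ L ∈ s, |R L S| < t) → ∀ L ∈ K, |R L S| < t + 2 * Real.sqrt (E / T) := by
    intro S hS hSs L hL
    obtain ⟨L', hL's, hLL⟩ := hs_net L hL
    have h1 : |(∫ y, f L y ∂σE) - ∫ y, f L' y ∂σE| ≤ Real.sqrt (E / T) := by
      rw [← integral_sub (hf_int L) (hf_int L')]
      have := norm_integral_le_of_norm_le_const (μ := σE) (f := fun y => f L y - f L' y)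
        (C := Real.sqrt (E / T)) (by
          filter_upwards [hsupp] with x hx using hf_lip L L' hLL x hx)
      simpa using this
    have h2 : |(1/(T:ℝ)) * ∑ j : Fin T, f L (S j) - (1/(T:ℝ)) * ∑ j : Fin T, f L' (S j)| ≤
        Real.sqrt (E / T) := by
      rw [← mul_sub, ← Finset.sum_sub_distrib, abs_mul, abs_of_pos (by positivity),
        one_div_mul_eq_div, div_le_iff₀ hT0]
      calc _ ≤ ∑ j : Fin T, |f L (S j) - f L' (S j)| := Finset.abs_sum_le_sum_abs _ _
        _ ≤ ∑ _j : Fin T, Real.sqrt (E / T) :=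
          Finset.sum_le_sum fun j _ => hf_lip L L' hLL _ (hS j)
        _ = _ := by simp [mul_comm]
    have h3 := hSs L' hL's
    simp only [R] at h3 ⊢
    rw [abs_lt] at h3 ⊢
    rw [abs_le] at h1 h2
    constructor <;> linarith [h1.1, h1.2, h2.1, h2.2, h3.1, h3.2]
  have hcover : Set.univ ⊆
      {S : Fin T → EuclideanSpace ℝ (Fin (2*M)) |
        ∀ B ∈ KK M, |R (Φ B) S| < t + 2 * Real.sqrt (E / T)} ∪
      ((⋃ L ∈ s, {S | t ≤ |R L S|}) ∪ {S | ∀ j, ‖S j‖ = Real.sqrt (2*E)}ᶜ) := by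
    intro S _
    by_cases hS : ∀ j, ‖S j‖ = Real.sqrt (2*E)
    · by_cases hSs : ∀ L ∈ s, |R L S| < t
      · exact Or.inl fun B hB => hgood S hS hSs _ ⟨B, hB, rfl⟩
      · push Not at hSs
        obtain ⟨L, hL, h⟩ := hSs
        exact Or.inr (Or.inl (Set.mem_biUnion hL h))
    · exact Or.inr (Or.inr hS)
  have hmain : ENNReal.ofReal (1 - δ) ≤ (Measure.pi fun _ : Fin T => σE)
      {S : Fin T → EuclideanSpace ℝ (Fin (2*M)) |
        ∀ B ∈ KK M, |R (Φ B) S| < t + 2 * Real.sqrt (E / T)} := by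
    rw [ENNReal.ofReal_sub _ hδ0.le, ENNReal.ofReal_one, tsub_le_iff_right]
    calc 1 = (Measure.pi fun _ : Fin T => σE) Set.univ := measure_univ.symm
      _ ≤ _ := (measure_mono hcover).trans (measure_union_le _ _)
      _ ≤ _ := by
        gcongr
        refine (measure_union_le _ _).trans ?_
        rw [hsphere, add_zero]
        exact hbad
  simp only [mv, map_sub]
  exact hmain
end
end

section
/- Let M ≥ 1 and let 0 < r ≤ 2. There exists a finite subset N ⊆ K(2M) with |N| ≤ (6/r)^{M²} such that for every O ∈ K(2M) there is g ∈ N with ‖O − g‖ ≤ r, where ‖·‖ is the ℓ²→ℓ² operator norm. -/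
open MeasureTheory Matrix

noncomputable section

open scoped ENNReal NNReal Matrix.Norms.L2Operator MatrixOrder ComplexOrder

theorem lintegral_complex_normSq {F : ℝ → ℝ≥0∞} (hF : Measurable F) :
    ∫⁻ z : ℂ, F (Complex.normSq z) =
      ENNReal.ofReal (2 * Real.pi) * ∫⁻ r in Set.Ioi (0 : ℝ), ENNReal.ofReal r * F (r ^ 2) := by
  rw [← Complex.lintegral_comp_polarCoord_symm]
  have h : ∀ p : ℝ × ℝ, ENNReal.ofReal p.1 • F (Complex.normSq (Complex.polarCoord.symm p)) =
      ENNReal.ofReal p.1 * F (p.1 ^ 2) := by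
    intro p
    rw [smul_eq_mul, Complex.normSq_eq_norm_sq, Complex.norm_polarCoord_symm, sq_abs]
  simp_rw [h]
  have hm : Measurable fun r : ℝ => ENNReal.ofReal r * F (r ^ 2) := by fun_prop
  rw [polarCoord_target, Measure.volume_eq_prod, ← Measure.prod_restrict,
    lintegral_prod _ (by fun_prop)]
  simp only [lintegral_const, MeasurableSet.univ, Measure.restrict_apply, Set.univ_inter,
    Real.volume_Ioo]
  rw [lintegral_mul_const _ hm, mul_comm]
  congr 2
  ring

theorem lintegral_complex_inv_pow {s : ℝ} (hs : 0 < s) (q : ℕ) :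
    ∫⁻ z : ℂ, ENNReal.ofReal ((s + Complex.normSq z)⁻¹ ^ (q + 2)) =
      ENNReal.ofReal (Real.pi / (q + 1) * s⁻¹ ^ (q + 1)) := by
  rw [lintegral_complex_normSq (F := fun x => ENNReal.ofReal ((s + x)⁻¹ ^ (q + 2))) (by fun_prop)]
  have hpos : ∀ r : ℝ, 0 < s + r ^ 2 := fun r => by positivity
  set g : ℝ → ℝ := fun r => -(2 * (q + 1) : ℝ)⁻¹ * (s + r ^ 2)⁻¹ ^ (q + 1) with hg
  set g' : ℝ → ℝ := fun r => r * (s + r ^ 2)⁻¹ ^ (q + 2) with hg'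
  have hd : ∀ r, HasDerivAt g (g' r) r := by
    intro r
    have h1 : HasDerivAt (fun r : ℝ => s + r ^ 2) (2 * r) r := by
      simpa using (hasDerivAt_pow 2 r).const_add s
    have h2 := ((h1.inv (hpos r).ne').pow (q + 1)).const_mul (-(2 * (q + 1) : ℝ)⁻¹)
    refine h2.congr_deriv ?_
    have := (hpos r).ne'
    have hq : (q : ℝ) + 1 ≠ 0 := by positivity
    simp only [hg', Nat.add_sub_cancel, Pi.inv_apply]
    push_cast
    rw [pow_add _ q 2]
    field_simp
  have ht : Filter.Tendsto g Filter.atTop (nhds 0) := by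
    have h1 : Filter.Tendsto (fun r : ℝ => s + r ^ 2) Filter.atTop Filter.atTop :=
      Filter.tendsto_atTop_add_const_left _ _ (Filter.tendsto_pow_atTop two_ne_zero)
    have h2 := (h1.inv_tendsto_atTop.pow (q + 1)).const_mul (-(2 * (q + 1) : ℝ)⁻¹)
    rw [zero_pow (by omega), mul_zero] at h2
    exact h2
  have hnn : ∀ r ∈ Set.Ioi (0 : ℝ), 0 ≤ g' r := by
    intro r hr
    have : (0 : ℝ) < r := hr
    have := hpos r
    positivity
  have hint := integrableOn_Ioi_deriv_of_nonneg' (fun r _ => hd r) hnn ht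
  have hI := integral_Ioi_of_hasDerivAt_of_tendsto (hd 0).continuousAt.continuousWithinAt
    (fun r _ => hd r) hint ht
  have h3 : ∫⁻ r in Set.Ioi (0 : ℝ), ENNReal.ofReal r * ENNReal.ofReal ((s + r ^ 2)⁻¹ ^ (q + 2)) =
      ENNReal.ofReal ((2 * (q + 1) : ℝ)⁻¹ * s⁻¹ ^ (q + 1)) := by
    have h4 := ofReal_integral_eq_lintegral_ofReal hint
      ((ae_restrict_iff' measurableSet_Ioi).2 (Filter.Eventually.of_forall hnn))
    rw [hI] at h4
    simp only [hg, zero_sub] at h4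
    norm_num at h4
    norm_num
    rw [h4]
    refine setLIntegral_congr_fun measurableSet_Ioi ?_
    intro r hr
    simp only [hg']
    rw [← ENNReal.ofReal_mul (le_of_lt hr)]
    norm_num
  rw [h3, ← ENNReal.ofReal_mul (by positivity)]
  congr 1
  field_simp

theorem lintegral_complex_sub_pow (s : ℝ) {m : ℕ} (hm : m ≠ 0) :
    ∫⁻ z : ℂ, ENNReal.ofReal (s - Complex.normSq z) ^ m =
      ENNReal.ofReal (Real.pi / (m + 1)) * ENNReal.ofReal s ^ (m + 1) := by
  rw [lintegral_complex_normSq (F := fun x => ENNReal.ofReal (s - x) ^ m) (by fun_prop)]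
  rcases le_or_gt s 0 with hs | hs
  · have : ∀ r : ℝ, ENNReal.ofReal r * ENNReal.ofReal (s - r ^ 2) ^ m = 0 := by
      intro r
      rw [ENNReal.ofReal_of_nonpos (p := s - r ^ 2) (by nlinarith [sq_nonneg r]), zero_pow hm,
        mul_zero]
    simp [this, ENNReal.ofReal_of_nonpos hs]
  set g : ℝ → ℝ := fun r => -(2 * (m + 1) : ℝ)⁻¹ * (s - r ^ 2) ^ (m + 1) with hg
  set g' : ℝ → ℝ := fun r => r * (s - r ^ 2) ^ m with hg'
  have hd : ∀ r, HasDerivAt g (g' r) r := by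
    intro r
    have h1 : HasDerivAt (fun r : ℝ => s - r ^ 2) (-(2 * r)) r := by
      simpa using (hasDerivAt_pow 2 r).const_sub s
    refine ((h1.pow (m + 1)).const_mul (-(2 * (m + 1) : ℝ)⁻¹)).congr_deriv ?_
    simp only [hg', Nat.add_sub_cancel]
    push_cast
    field_simp
  have hsq : √s ^ 2 = s := Real.sq_sqrt hs.le
  have hcont : Continuous g' := by fun_prop
  have hI : ∫ r in (0 : ℝ)..√s, g' r = (2 * (m + 1) : ℝ)⁻¹ * s ^ (m + 1) := by
    rw [intervalIntegral.integral_eq_sub_of_hasDerivAt (fun r _ => hd r)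
      (hcont.intervalIntegrable _ _)]
    simp [hg, hsq]
  have hle : ∀ r ∈ Set.Ioc 0 √s, 0 ≤ s - r ^ 2 := by
    intro r hr
    have := hr.1
    have := hr.2
    nlinarith
  rw [intervalIntegral.integral_of_le (Real.sqrt_nonneg s)] at hI
  have h3 : ∫⁻ r in Set.Ioi (0 : ℝ), ENNReal.ofReal r * ENNReal.ofReal (s - r ^ 2) ^ m =
      ∫⁻ r in Set.Ioc 0 √s, ENNReal.ofReal (g' r) := by
    rw [← lintegral_indicator measurableSet_Ioi, ← lintegral_indicator measurableSet_Ioc]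
    congr 1
    ext r
    by_cases h0 : 0 < r
    · rw [Set.indicator_of_mem (by exact h0)]
      by_cases h1 : r ≤ √s
      · rw [Set.indicator_of_mem (show r ∈ Set.Ioc 0 √s from ⟨h0, h1⟩), ENNReal.ofReal_mul h0.le,
          ENNReal.ofReal_pow (hle r (show r ∈ Set.Ioc 0 √s from ⟨h0, h1⟩))]
      · rw [Set.indicator_of_notMem (fun h => h1 h.2), ENNReal.ofReal_of_nonpos (p := s - r ^ 2),
          zero_pow hm, mul_zero]
        push Not at h1
        have := Real.sqrt_nonneg s
        nlinarith
    · rw [Set.indicator_of_notMem (by exact h0), Set.indicator_of_notMem (fun h => h0 h.1)]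
  have hint : IntegrableOn g' (Set.Ioc 0 √s) :=
    (hcont.integrableOn_Icc).mono_set Set.Ioc_subset_Icc_self
  rw [h3, ← ofReal_integral_eq_lintegral_ofReal hint
    ((ae_restrict_iff' measurableSet_Ioc).2 (Filter.Eventually.of_forall fun r hr =>
      mul_nonneg hr.1.le (pow_nonneg (hle r hr) m))), hI, ← ENNReal.ofReal_mul (by positivity),
    ← ENNReal.ofReal_pow hs.le, ← ENNReal.ofReal_mul (by positivity)]
  congr 1
  field_simp

theorem lintegral_fin_succ_complex {d : ℕ} {F : ℝ → ℝ≥0∞} (hF : Measurable F) :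
    ∫⁻ w : Fin (d + 1) → ℂ, F (∑ i, Complex.normSq (w i)) =
      ∫⁻ z : ℂ, ∫⁻ w : Fin d → ℂ, F (Complex.normSq z + ∑ i, Complex.normSq (w i)) := by
  have hc : Continuous Complex.normSq := Complex.continuous_normSq
  have hm : Measurable fun p : ℂ × (Fin d → ℂ) =>
      F (Complex.normSq p.1 + ∑ i, Complex.normSq (p.2 i)) := by
    refine hF.comp (Continuous.measurable ?_)
    fun_prop
  rw [← lintegral_prod _ hm.aemeasurable, ← Measure.volume_eq_prod]
  rw [← (volume_preserving_piFinSuccAbove (fun _ : Fin (d + 1) => ℂ) 0).lintegral_comp hm]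
  congr 1
  ext w
  simp [Fin.sum_univ_succ, MeasurableEquiv.piFinSuccAbove, Fin.insertNthEquiv, Fin.tail]

theorem lintegral_pi_complex_inv_pow (d : ℕ) : ∀ (q : ℕ) {s : ℝ}, 0 < s →
    ∫⁻ w : Fin d → ℂ, ENNReal.ofReal ((s + ∑ i, Complex.normSq (w i))⁻¹ ^ (q + d + 1)) =
      ENNReal.ofReal (Real.pi ^ d * q.factorial / (q + d).factorial * s⁻¹ ^ (q + 1)) := by
  induction d with
  | zero =>
    intro q s hs
    have : (q.factorial : ℝ) ≠ 0 := by positivity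
    simp [this, lintegral_const, volume_pi]
  | succ d ih =>
    intro q s hs
    rw [lintegral_fin_succ_complex
      (F := fun x => ENNReal.ofReal ((s + x)⁻¹ ^ (q + (d + 1) + 1))) (by fun_prop)]
    have h : ∀ z : ℂ, ∫⁻ w : Fin d → ℂ, ENNReal.ofReal
        ((s + (Complex.normSq z + ∑ i, Complex.normSq (w i)))⁻¹ ^ (q + (d + 1) + 1)) =
        ENNReal.ofReal (Real.pi ^ d * (q + 1).factorial / (q + 1 + d).factorial) *
          ENNReal.ofReal ((s + Complex.normSq z)⁻¹ ^ (q + 2)) := by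
      intro z
      have hz : 0 < s + Complex.normSq z := by
        have := Complex.normSq_nonneg z
        positivity
      rw [← ENNReal.ofReal_mul (by positivity), ← ih (q + 1) hz]
      simp only [add_assoc, add_comm 1 d]
    simp_rw [h]
    rw [lintegral_const_mul' _ _ ENNReal.ofReal_ne_top, lintegral_complex_inv_pow hs,
      ← ENNReal.ofReal_mul (by positivity)]
    congr 1
    rw [show q + 1 + d = q + (d + 1) by ring, Nat.factorial_succ q]
    push_cast
    field_simp
    ring

theorem lintegral_pi_complex_sub_pow (d : ℕ) : ∀ (s : ℝ) {m : ℕ}, m ≠ 0 →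
    ∫⁻ w : Fin d → ℂ, ENNReal.ofReal (s - ∑ i, Complex.normSq (w i)) ^ m =
      ENNReal.ofReal (Real.pi ^ d * m.factorial / (m + d).factorial) *
        ENNReal.ofReal s ^ (m + d) := by
  induction d with
  | zero =>
    intro s m hm
    have : (m.factorial : ℝ) ≠ 0 := by positivity
    simp [this, lintegral_const, volume_pi]
  | succ d ih =>
    intro s m hm
    rw [lintegral_fin_succ_complex
      (F := fun x => ENNReal.ofReal (s - x) ^ m) (by fun_prop)]
    simp_rw [← sub_sub, ih _ hm]
    rw [lintegral_const_mul' _ _ ENNReal.ofReal_ne_top, lintegral_complex_sub_pow s (by omega),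
      ← mul_assoc, ← ENNReal.ofReal_mul (by positivity)]
    congr 2
    rw [← add_assoc, Nat.factorial_succ (m + d)]
    push_cast
    field_simp
    ring

theorem lintegral_inv_add_sq_pow_le {s : ℝ} (hs : 0 < s) (m : ℝ) (p : ℕ) :
    ∫⁻ a : ℝ, ENNReal.ofReal ((s ^ 2 + (a - m) ^ 2)⁻¹ ^ (p + 1)) ≤
      ENNReal.ofReal (Real.pi * s⁻¹ ^ (2 * p + 1)) := by
  rw [lintegral_sub_right_eq_self (fun a => ENNReal.ofReal ((s ^ 2 + a ^ 2)⁻¹ ^ (p + 1))) m]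
  have hi : Integrable fun a : ℝ => (s ^ 2)⁻¹ ^ (p + 1) * (1 + (a / s) ^ 2)⁻¹ :=
    (integrable_inv_one_add_sq.comp_div hs.ne').const_mul _
  have hI : ∫ a : ℝ, (s ^ 2)⁻¹ ^ (p + 1) * (1 + (a / s) ^ 2)⁻¹ =
      Real.pi * s⁻¹ ^ (2 * p + 1) := by
    rw [integral_const_mul, Measure.integral_comp_div (fun a : ℝ => (1 + a ^ 2)⁻¹),
      integral_univ_inv_one_add_sq, abs_of_pos hs, smul_eq_mul, ← inv_pow, ← pow_mul,
      show 2 * (p + 1) = 2 * p + 1 + 1 by ring, pow_succ]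
    field_simp
  rw [← hI, ofReal_integral_eq_lintegral_ofReal hi
    (Filter.Eventually.of_forall fun a => by positivity)]
  refine lintegral_mono fun a => ENNReal.ofReal_le_ofReal ?_
  have h1 : (s ^ 2 + a ^ 2)⁻¹ = (s ^ 2)⁻¹ * (1 + (a / s) ^ 2)⁻¹ := by
    field_simp
  rw [h1, mul_pow]
  refine mul_le_mul_of_nonneg_left ?_ (by positivity)
  refine pow_le_of_le_one (by positivity) (inv_le_one_of_one_le₀ ?_) (by omega)
  nlinarith [sq_nonneg (a / s)]

theorem le_lintegral_sq_sub_sq_pow {s : ℝ} (hs : 0 < s) (m : ℝ) (k : ℕ) :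
    ENNReal.ofReal (2 * (2 / 3) ^ k * s ^ (2 * k + 1)) ≤
      ∫⁻ a in Set.Ioo (m - s) (m + s), ENNReal.ofReal ((s ^ 2 - (a - m) ^ 2) ^ k) := by
  set g : ℝ → ℝ := fun a =>
    (2 / 3 * s ^ 2) ^ k * (1 + k * (3 / 2 * (1 - (a - m) ^ 2 / s ^ 2) - 1)) with hg
  have hc : Continuous g := by fun_prop
  have hI : ∫ a in Set.Ioo (m - s) (m + s), g a = 2 * (2 / 3) ^ k * s ^ (2 * k + 1) := by
    rw [← integral_Ioc_eq_integral_Ioo, ← intervalIntegral.integral_of_le (by linarith)]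
    set G : ℝ → ℝ := fun a => (2 / 3 * s ^ 2) ^ k *
      (a + k * (a / 2 - 1 / 2 * (a - m) ^ 3 / s ^ 2))
    have hd : ∀ a, HasDerivAt G (g a) a := by
      intro a
      have h3 : HasDerivAt (fun a : ℝ => (a - m) ^ 3) (3 * (a - m) ^ 2) a := by
        refine (((hasDerivAt_id a).sub_const m).pow 3).congr_deriv ?_
        simp
      have h4 := ((hasDerivAt_id a).div_const 2).sub ((h3.const_mul (1 / 2)).div_const (s ^ 2))
      refine (((hasDerivAt_id a).add (h4.const_mul (k : ℝ))).const_mul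
        ((2 / 3 * s ^ 2) ^ k)).congr_deriv ?_
      simp only [hg]
      field_simp
      ring
    rw [intervalIntegral.integral_eq_sub_of_hasDerivAt (fun a _ => hd a)
      (hc.intervalIntegrable _ _)]
    simp only [G]
    rw [mul_pow, ← pow_mul, pow_succ]
    field_simp
    ring
  rw [← hI]
  have hh : Continuous fun a : ℝ => (s ^ 2 - (a - m) ^ 2) ^ k := by fun_prop
  have hnn : ∀ a ∈ Set.Ioo (m - s) (m + s), 0 ≤ s ^ 2 - (a - m) ^ 2 := by
    intro a ha
    have := ha.1
    have := ha.2
    nlinarith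
  have hint : ∀ {f : ℝ → ℝ}, Continuous f → IntegrableOn f (Set.Ioo (m - s) (m + s)) := fun hf =>
    hf.integrableOn_Icc.mono_set Set.Ioo_subset_Icc_self
  rw [← ofReal_integral_eq_lintegral_ofReal (hint hh)
    ((ae_restrict_iff' measurableSet_Ioo).2 (Filter.Eventually.of_forall fun a ha =>
      pow_nonneg (hnn a ha) k))]
  refine ENNReal.ofReal_le_ofReal
    (setIntegral_mono_on (hint hc) (hint hh) measurableSet_Ioo fun a ha => ?_)
  have hy : 0 ≤ 1 - (a - m) ^ 2 / s ^ 2 := by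
    have := hnn a ha
    rw [sub_nonneg, div_le_one (by positivity)]
    linarith
  have hb := one_add_mul_le_pow (a := 3 / 2 * (1 - (a - m) ^ 2 / s ^ 2) - 1) (by linarith) k
  calc g a ≤ (2 / 3 * s ^ 2) ^ k * (1 + (3 / 2 * (1 - (a - m) ^ 2 / s ^ 2) - 1)) ^ k :=
        mul_le_mul_of_nonneg_left hb (by positivity)
    _ = (s ^ 2 - (a - m) ^ 2) ^ k := by
        rw [← mul_pow]
        congr 1
        field_simp
        ring

section MatrixAlgebra

variable {n : Type*} [Fintype n] [DecidableEq n]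

theorem norm_le_of_posSemidef {A : Matrix n n ℂ} {s : ℝ} (hs : 0 ≤ s)
    (h : ((s ^ 2 : ℝ) • (1 : Matrix n n ℂ) - Aᴴ * A).PosSemidef) : ‖A‖ ≤ s := by
  let _ : CStarAlgebra (Matrix n n ℂ) := {}
  have h1 : ‖Aᴴ * A‖ ≤ s ^ 2 :=
    (CStarAlgebra.norm_le_iff_le_algebraMap _ (sq_nonneg s)
      (posSemidef_conjTranspose_mul_self A).nonneg).2 (by
        rw [Algebra.algebraMap_eq_smul_one]
        exact Matrix.le_iff.2 h)
  rw [l2_opNorm_conjTranspose_mul_self] at h1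
  nlinarith [norm_nonneg A]

theorem posSemidef_of_norm_le {A : Matrix n n ℂ} {s : ℝ} (h : ‖A‖ ≤ s) :
    ((s ^ 2 : ℝ) • (1 : Matrix n n ℂ) - Aᴴ * A).PosSemidef := by
  let _ : CStarAlgebra (Matrix n n ℂ) := {}
  have h1 : Aᴴ * A ≤ algebraMap ℝ _ (s ^ 2) :=
    (CStarAlgebra.norm_le_iff_le_algebraMap _ (sq_nonneg s)
      (posSemidef_conjTranspose_mul_self A).nonneg).1 (by
        rw [l2_opNorm_conjTranspose_mul_self]
        nlinarith [norm_nonneg A])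
  rw [Algebra.algebraMap_eq_smul_one] at h1
  exact Matrix.le_iff.1 h1

theorem posDef_one_sub_mul_self {H : Matrix n n ℂ} (hH : H.IsHermitian) (h : ‖H‖ < 1) :
    (1 - H * H).PosDef := by
  have h1 := posSemidef_of_norm_le (le_refl ‖H‖)
  have h2 : ((1 - ‖H‖ ^ 2 : ℝ) • (1 : Matrix n n ℂ)).PosDef :=
    PosDef.one.smul (by nlinarith [norm_nonneg H])
  convert h2.add_posSemidef h1 using 1
  rw [hH.eq, sub_smul, one_smul]
  abel

theorem posDef_one_add_mul_self {H : Matrix n n ℂ} (hH : H.IsHermitian) :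
    (1 + H * H).PosDef := by
  have := PosDef.one.add_posSemidef (posSemidef_conjTranspose_mul_self H)
  rwa [hH.eq] at this

theorem posDef_one_sub {H : Matrix n n ℂ} (hH : H.IsHermitian) (h : ‖H‖ < 1) :
    (1 - H).PosDef := by
  have h1 := posSemidef_conjTranspose_mul_self (1 - H)
  have h2 := (posDef_one_sub_mul_self hH h).add_posSemidef h1
  convert h2.smul (show (0 : ℝ) < 1 / 2 by norm_num) using 1
  rw [conjTranspose_sub, hH.eq, conjTranspose_one]
  have : 1 - H * H + (1 - H) * (1 - H) = (2 : ℝ) • (1 - H) := by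
    rw [two_smul]
    noncomm_ring
  rw [this, smul_smul]
  norm_num

theorem posDef_one_add {H : Matrix n n ℂ} (hH : H.IsHermitian) (h : ‖H‖ < 1) :
    (1 + H).PosDef := by
  have := posDef_one_sub (H := -H) hH.neg (by rwa [norm_neg])
  rwa [sub_neg_eq_add] at this

theorem norm_le_one_of_posSemidef {H : Matrix n n ℂ} (hH : H.IsHermitian)
    (h1 : (1 - H).PosSemidef) (h2 : (1 + H).PosSemidef) : ‖H‖ ≤ 1 := by
  refine norm_le_of_posSemidef zero_le_one ?_
  have h3 := (h1.conjTranspose_mul_mul_same (1 + H)).add (h2.conjTranspose_mul_mul_same (1 - H))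
  rw [h1.1.eq, h2.1.eq] at h3
  convert h3.smul (show (0 : ℝ) ≤ 1 / 2 by norm_num) using 1
  have : (1 + H) * (1 - H) * (1 + H) + (1 - H) * (1 + H) * (1 - H) =
      (2 : ℝ) • (1 - H * H) := by
    rw [two_smul]
    noncomm_ring
  rw [this, smul_smul, hH.eq]
  norm_num

theorem exists_mul_conjTranspose_eq {S : Matrix n n ℂ} (hS : S.PosDef) :
    ∃ T : Matrix n n ℂ, T * Tᴴ = S ∧ IsUnit T.det := by
  obtain ⟨B, hB⟩ := CStarAlgebra.nonneg_iff_eq_star_mul_self.mp hS.posSemidef.nonneg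
  refine ⟨Bᴴ, by rw [conjTranspose_conjTranspose]; exact hB.symm, ?_⟩
  have h := hS.isUnit
  rw [isUnit_iff_isUnit_det, hB, det_mul] at h
  exact isUnit_of_mul_isUnit_left h

/-- The modulus of `det (1 - ω² H²)`, in factored form. -/
def pairDet (ω : ℂ) (H : Matrix n n ℂ) : ℝ := ‖det (1 + ω • H) * det (1 - ω • H)‖

theorem pairDet_eq (ω : ℂ) (H : Matrix n n ℂ) : pairDet ω H = ‖det (1 - ω ^ 2 • (H * H))‖ := by
  rw [pairDet, ← det_mul]
  congr 2
  simp only [add_mul, mul_sub, mul_one, one_mul, smul_mul_smul_comm, sq]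
  abel

theorem continuous_pairDet (ω : ℂ) : Continuous (pairDet (n := n) ω) := by
  unfold pairDet
  fun_prop

theorem pairDet_reindex {m : Type*} [Fintype m] [DecidableEq m] (ω : ℂ) (e : n ≃ m)
    (H : Matrix n n ℂ) : pairDet ω (reindex e e H) = pairDet ω H := by
  have h1 : 1 + ω • reindex e e H = reindex e e (1 + ω • H) := by
    simp [submatrix_add, submatrix_smul]
  have h2 : 1 - ω • reindex e e H = reindex e e (1 - ω • H) := by
    simp [submatrix_sub, submatrix_smul]
  rw [pairDet, h1, h2, det_reindex_self, det_reindex_self, pairDet]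

/-- The Hermitian matrix `H` bordered by the column `v`, the row `vᴴ` and the corner entry `a`. -/
def bordered (H : Matrix n n ℂ) (v : n → ℂ) (a : ℝ) : Matrix (n ⊕ Fin 1) (n ⊕ Fin 1) ℂ :=
  fromBlocks H (replicateCol (Fin 1) v) (replicateCol (Fin 1) v)ᴴ (diagonal fun _ => (a : ℂ))

theorem isHermitian_bordered {m : Type*} {H : Matrix m m ℂ} (hH : H.IsHermitian) (v : m → ℂ)
    (a : ℝ) :
    (bordered H v a).IsHermitian := by
  rw [bordered, isHermitian_fromBlocks_iff]
  refine ⟨hH, rfl, conjTranspose_conjTranspose _, ?_⟩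
  ext i j
  fin_cases i; fin_cases j
  simp

theorem one_add_smul_bordered {m : Type*} [DecidableEq m] (ω : ℂ) (H : Matrix m m ℂ) (v : m → ℂ)
    (a : ℝ) :
    1 + ω • bordered H v a = fromBlocks (1 + ω • H) (ω • replicateCol (Fin 1) v)
      (ω • (replicateCol (Fin 1) v)ᴴ) (diagonal fun _ => 1 + ω * a) := by
  rw [bordered, fromBlocks_smul, ← fromBlocks_one, fromBlocks_add]
  congr 1
  · simp
  · simp
  · ext i j
    fin_cases i; fin_cases j
    simp

theorem det_one_add_smul_bordered {ω : ℂ} {H B : Matrix n n ℂ} (v : n → ℂ) (a : ℝ)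
    (hB : (1 + ω • H) * B = 1) :
    det (1 + ω • bordered H v a) =
      det (1 + ω • H) * (1 + ω * a - ω ^ 2 * (star v ⬝ᵥ B *ᵥ v)) := by
  let _ : Invertible (1 + ω • H) := invertibleOfRightInverse _ B hB
  have hinv : ⅟(1 + ω • H) = B := invOf_eq_right_inv hB
  rw [one_add_smul_bordered, det_fromBlocks₁₁, hinv, det_unique (n := Fin 1)]
  congr 1
  rw [Matrix.sub_apply, diagonal_apply_eq, sub_right_inj, Matrix.smul_mul, Matrix.smul_mul,
    Matrix.mul_smul, smul_smul, Matrix.smul_apply, ← sq, smul_eq_mul, Matrix.mul_assoc]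
  congr 1

theorem pairDet_bordered {ω : ℂ} {H R : Matrix n n ℂ} (v : n → ℂ) (a : ℝ)
    (hR : (1 - ω ^ 2 • (H * H)) * R = 1) :
    pairDet ω (bordered H v a) = pairDet ω H *
      ‖(1 - ω ^ 2 * (star v ⬝ᵥ R *ᵥ v)) ^ 2 -
        ω ^ 2 * (a + ω ^ 2 * (star v ⬝ᵥ (H * R) *ᵥ v)) ^ 2‖ := by
  have h1 : (1 + ω • H) * (R - ω • (H * R)) = 1 := by
    refine Eq.trans ?_ hR
    simp only [add_mul, mul_sub, one_mul, smul_mul_assoc, mul_smul_comm, sub_mul,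
      smul_add, smul_smul, Matrix.mul_assoc, sq]
    abel
  have h2 : (1 + (-ω) • H) * (R + ω • (H * R)) = 1 := by
    refine Eq.trans ?_ hR
    simp only [add_mul, mul_add, one_mul, smul_mul_assoc, mul_smul_comm, sub_mul,
      smul_add, smul_neg, smul_smul, Matrix.mul_assoc, neg_smul, neg_mul, sq]
    abel
  have h3 : ∀ K : Matrix (n ⊕ Fin 1) (n ⊕ Fin 1) ℂ, 1 - ω • K = 1 + (-ω) • K := by
    intro K; rw [neg_smul, sub_eq_add_neg]
  have h4 : 1 - ω • H = 1 + (-ω) • H := by rw [neg_smul, sub_eq_add_neg]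
  rw [pairDet, h3, det_one_add_smul_bordered v a h1, det_one_add_smul_bordered v a h2, ← h4,
    pairDet, ← norm_mul]
  congr 1
  simp only [sub_mulVec, add_mulVec, smul_mulVec, dotProduct_sub, dotProduct_add, dotProduct_smul,
    smul_eq_mul]
  ring

theorem posSemidef_one_add_bordered {H R : Matrix n n ℂ} (hH : H.IsHermitian) (hn : ‖H‖ < 1)
    (v : n → ℂ) (a : ℝ) (hR : (1 - H * H) * R = 1)
    (h : 0 ≤ 1 + (a : ℂ) - (star v ⬝ᵥ R *ᵥ v - star v ⬝ᵥ (H * R) *ᵥ v)) :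
    (1 + bordered H v a).PosSemidef := by
  have h1 : (1 + H) * (R - H * R) = 1 := by
    refine Eq.trans ?_ hR
    noncomm_ring
  have hB := one_add_smul_bordered 1 H v a
  simp only [one_smul, one_mul] at hB
  let _ : Invertible (1 + H) := invertibleOfRightInverse _ _ h1
  rw [hB, PosDef.fromBlocks₁₁ _ _ (posDef_one_add hH hn), inv_eq_right_inv h1]
  have h2 : (diagonal fun _ => 1 + (a : ℂ)) - (replicateCol (Fin 1) v)ᴴ * (R - H * R) *
      replicateCol (Fin 1) v =
      diagonal fun _ : Fin 1 => 1 + (a : ℂ) - (star v ⬝ᵥ R *ᵥ v - star v ⬝ᵥ (H * R) *ᵥ v) := by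
    ext i j
    fin_cases i; fin_cases j
    rw [← dotProduct_sub, ← sub_mulVec, Matrix.mul_assoc]
    rw [Matrix.sub_apply, diagonal_apply_eq, diagonal_apply_eq, sub_right_inj]
    rfl
  rw [h2]
  exact PosSemidef.diagonal fun _ => h

theorem bordered_neg {m : Type*} (H : Matrix m m ℂ) (v : m → ℂ) (a : ℝ) :
    -bordered H v a = bordered (-H) (-v) (-a) := by
  rw [bordered, bordered, fromBlocks_neg]
  congr 1
  ext i j
  fin_cases i; fin_cases j
  simp

theorem norm_bordered_le_one {H R : Matrix n n ℂ} (hH : H.IsHermitian) (hn : ‖H‖ < 1)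
    (v : n → ℂ) (a x z : ℝ) (hR : (1 - H * H) * R = 1) (hx : star v ⬝ᵥ R *ᵥ v = x)
    (hz : star v ⬝ᵥ (H * R) *ᵥ v = z) (h1 : 0 ≤ 1 - x + (a + z)) (h2 : 0 ≤ 1 - x - (a + z)) :
    ‖bordered H v a‖ ≤ 1 := by
  refine norm_le_one_of_posSemidef (isHermitian_bordered hH v a) ?_ ?_
  · rw [sub_eq_add_neg, bordered_neg]
    refine posSemidef_one_add_bordered (R := R) hH.neg (by rwa [norm_neg]) _ _
      (by rwa [neg_mul_neg]) ?_
    have : star (-v) ⬝ᵥ (-H * R) *ᵥ (-v) = -(z : ℂ) := by simp [← hz, neg_mulVec, mulVec_neg]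
    rw [this]
    have : star (-v) ⬝ᵥ R *ᵥ (-v) = (x : ℂ) := by simp [← hx, mulVec_neg]
    rw [this]
    have : (0 : ℝ) ≤ 1 + (-a) - (x - (-z)) := by linarith
    exact_mod_cast this
  · refine posSemidef_one_add_bordered (R := R) hH hn _ _ hR ?_
    rw [hx, hz]
    have : (0 : ℝ) ≤ 1 + a - (x - z) := by linarith
    exact_mod_cast this

end MatrixAlgebra

section Fibre

variable {n : Type*} [Fintype n] [DecidableEq n]

theorem lintegral_comp_mulVec {T : Matrix n n ℂ} (hT : IsUnit T.det) (F : (n → ℂ) → ℝ≥0∞) :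
    ∫⁻ v, F v = ENNReal.ofReal (Complex.normSq T.det) * ∫⁻ u, F (T *ᵥ u) := by
  set f : (n → ℂ) →ₗ[ℝ] (n → ℂ) := (Matrix.toLin' T).restrictScalars ℝ with hf
  have hdet : LinearMap.det f = Complex.normSq T.det := by
    rw [hf, LinearMap.det_restrictScalars, LinearMap.det_toLin', Algebra.norm_complex_apply]
  have hpos : 0 < Complex.normSq T.det := Complex.normSq_pos.2 hT.ne_zero
  have hne : LinearMap.det f ≠ 0 := by rw [hdet]; exact hpos.ne'
  have hemb : MeasurableEmbedding f :=
    (LinearEquiv.ofIsUnitDet (f := f) (v := Module.finBasis ℝ (n → ℂ))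
      (v' := Module.finBasis ℝ (n → ℂ))
      (by rw [LinearMap.det_toMatrix]; exact hne.isUnit)).toContinuousLinearEquiv.toHomeomorph
      |>.measurableEmbedding
  have h := hemb.lintegral_map (μ := volume) F
  rw [Measure.map_linearMap_addHaar_eq_smul_addHaar volume hne, lintegral_smul_measure, hdet,
    abs_of_pos (inv_pos.2 hpos)] at h
  have h' : ∫⁻ u, F (T *ᵥ u) = ∫⁻ u, F (f u) := rfl
  rw [h', ← h, smul_eq_mul, ← mul_assoc, ← ENNReal.ofReal_mul hpos.le, mul_inv_cancel₀ hpos.ne',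
    ENNReal.ofReal_one, one_mul]

theorem exists_substitution {ω : ℂ} {H : Matrix n n ℂ}
    (hH : H.IsHermitian) (hS : (1 - ω ^ 2 • (H * H)).PosDef) :
    ∃ (T R : Matrix n n ℂ) (z : (n → ℂ) → ℝ), IsUnit T.det ∧
      Complex.normSq T.det = pairDet ω H ∧ (1 - ω ^ 2 • (H * H)) * R = 1 ∧ ∀ u,
        star (T *ᵥ u) ⬝ᵥ R *ᵥ (T *ᵥ u) = ((∑ i, Complex.normSq (u i) : ℝ) : ℂ) ∧
        star (T *ᵥ u) ⬝ᵥ (H * R) *ᵥ (T *ᵥ u) = (z u : ℂ) := by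
  set S := 1 - ω ^ 2 • (H * H) with hSdef
  obtain ⟨T, hT, hu⟩ := exists_mul_conjTranspose_eq hS
  have hSu : IsUnit S.det := (isUnit_iff_isUnit_det S).1 hS.isUnit
  have hSR : S * S⁻¹ = 1 := mul_nonsing_inv S hSu
  have hcomm : H * S⁻¹ = S⁻¹ * H := by
    have h1 : S * H = H * S := by
      rw [hSdef]
      simp only [sub_mul, mul_sub, one_mul, mul_one, smul_mul_assoc, mul_smul_comm,
        Matrix.mul_assoc]
    calc H * S⁻¹ = S⁻¹ * S * H * S⁻¹ := by rw [nonsing_inv_mul S hSu, one_mul]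
      _ = S⁻¹ * H := by rw [mul_assoc _ S, h1, ← mul_assoc, mul_assoc, hSR, mul_one]
  have hherm : (H * S⁻¹).IsHermitian := by
    rw [IsHermitian, conjTranspose_mul, hS.inv.1.eq, hH.eq, hcomm]
  refine ⟨T, S⁻¹, fun u => (star (T *ᵥ u) ⬝ᵥ (H * S⁻¹) *ᵥ (T *ᵥ u)).re, hu, ?_, hSR,
    fun u => ⟨?_, ?_⟩⟩
  · rw [pairDet_eq, ← hSdef, ← hT, det_mul, det_conjTranspose, norm_mul, norm_star,
      Complex.normSq_eq_norm_sq, sq]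
  · have h1 : Tᴴ * (S⁻¹ * T) = 1 := by
      rw [← hT, Matrix.mul_inv_rev, mul_assoc, nonsing_inv_mul T hu, mul_one, mul_nonsing_inv]
      rw [det_conjTranspose]
      exact hu.star
    rw [star_mulVec, ← dotProduct_mulVec, mulVec_mulVec, mulVec_mulVec, Matrix.mul_assoc, h1,
      one_mulVec]
    push_cast
    refine Finset.sum_congr rfl fun i _ => ?_
    exact (Complex.normSq_eq_conj_mul_self).symm
  · exact Complex.ext rfl (hherm.im_star_dotProduct_mulVec_self _)

theorem lintegral_fibre_inv_le {d : ℕ} {H : Matrix (Fin d) (Fin d) ℂ} (hH : H.IsHermitian) :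
    ∫⁻ v, ∫⁻ a, ENNReal.ofReal ((pairDet Complex.I (bordered H v a))⁻¹ ^ (d + 1)) ≤
      ENNReal.ofReal (Real.pi * (Real.pi ^ d * d.factorial / (d + d).factorial)) *
        ENNReal.ofReal ((pairDet Complex.I H)⁻¹ ^ d) := by
  have hI : Complex.I ^ 2 = ((-1 : ℝ) : ℂ) := by simp
  have hS : (1 - Complex.I ^ 2 • (H * H)).PosDef := by
    convert posDef_one_add_mul_self hH using 1
    simp
  obtain ⟨T, R, z, hT, hdet, hR, hq⟩ := exists_substitution hH hS
  set q := pairDet Complex.I H with hqdef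
  have hqpos : 0 < q := hdet ▸ Complex.normSq_pos.2 hT.ne_zero
  have hb : ∀ u a, pairDet Complex.I (bordered H (T *ᵥ u) a) =
      q * ((1 + ∑ i, Complex.normSq (u i)) ^ 2 + (a - z u) ^ 2) := by
    intro u a
    rw [pairDet_bordered _ _ hR, (hq u).1, (hq u).2, hI]
    congr 1
    have : ((1 : ℂ) - ((-1 : ℝ) : ℂ) * ((∑ i, Complex.normSq (u i) : ℝ) : ℂ)) ^ 2 -
        ((-1 : ℝ) : ℂ) * ((a : ℂ) + ((-1 : ℝ) : ℂ) * (z u : ℂ)) ^ 2 =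
        (((1 + ∑ i, Complex.normSq (u i)) ^ 2 + (a - z u) ^ 2 : ℝ) : ℂ) := by
      push_cast
      ring
    rw [this, Complex.norm_real, Real.norm_of_nonneg (by positivity)]
  rw [lintegral_comp_mulVec hT, hdet]
  have hinner : ∀ u : Fin d → ℂ, ∫⁻ a, ENNReal.ofReal
      ((pairDet Complex.I (bordered H (T *ᵥ u) a))⁻¹ ^ (d + 1)) ≤
      ENNReal.ofReal (q⁻¹ ^ (d + 1) * Real.pi) *
        ENNReal.ofReal ((1 + ∑ i, Complex.normSq (u i))⁻¹ ^ (d + d + 1)) := by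
    intro u
    have hpos : 0 < 1 + ∑ i, Complex.normSq (u i) := by
      have : 0 ≤ ∑ i, Complex.normSq (u i) := Finset.sum_nonneg fun i _ => Complex.normSq_nonneg _
      positivity
    simp_rw [hb, mul_inv, mul_pow]
    simp_rw [ENNReal.ofReal_mul (show 0 ≤ q⁻¹ ^ (d + 1) by positivity)]
    rw [lintegral_const_mul' _ _ ENNReal.ofReal_ne_top, mul_assoc]
    refine mul_le_mul_right ?_ _
    refine (lintegral_inv_add_sq_pow_le hpos (z u) d).trans_eq ?_
    rw [ENNReal.ofReal_mul Real.pi_pos.le, two_mul]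
  refine (mul_le_mul_right (lintegral_mono hinner) _).trans_eq ?_
  rw [lintegral_const_mul' _ _ ENNReal.ofReal_ne_top, lintegral_pi_complex_inv_pow d d one_pos,
    ← ENNReal.ofReal_mul (by positivity), ← ENNReal.ofReal_mul (by positivity),
    ← ENNReal.ofReal_mul (by positivity)]
  congr 1
  rw [pow_succ, inv_one, one_pow]
  field_simp

theorem le_lintegral_fibre {d : ℕ} {H : Matrix (Fin d) (Fin d) ℂ} (hH : H.IsHermitian)
    (hn : ‖H‖ < 1) (k : ℕ) :
    ENNReal.ofReal (2 * (2 / 3) ^ k *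
        (Real.pi ^ d * (2 * k + 1).factorial / (2 * k + 1 + d).factorial)) *
      ENNReal.ofReal (pairDet 1 H ^ (k + 1)) ≤
    ∫⁻ v, ∫⁻ a, Set.indicator {a : ℝ | ‖bordered H v a‖ ≤ 1}
      (fun a => ENNReal.ofReal (pairDet 1 (bordered H v a) ^ k)) a := by
  have hI : (1 : ℂ) ^ 2 = ((1 : ℝ) : ℂ) := by simp
  have hS : (1 - (1 : ℂ) ^ 2 • (H * H)).PosDef := by
    convert posDef_one_sub_mul_self hH hn using 1
    simp
  obtain ⟨T, R, z, hT, hdet, hR, hq⟩ := exists_substitution hH hS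
  set q := pairDet 1 H with hqdef
  have hqpos : 0 < q := hdet ▸ Complex.normSq_pos.2 hT.ne_zero
  have hb : ∀ u a, pairDet 1 (bordered H (T *ᵥ u) a) =
      q * |(1 - ∑ i, Complex.normSq (u i)) ^ 2 - (a - (- z u)) ^ 2| := by
    intro u a
    rw [pairDet_bordered _ _ hR, (hq u).1, (hq u).2, hI]
    congr 1
    have : ((1 : ℂ) - ((1 : ℝ) : ℂ) * ((∑ i, Complex.normSq (u i) : ℝ) : ℂ)) ^ 2 -
        ((1 : ℝ) : ℂ) * ((a : ℂ) + ((1 : ℝ) : ℂ) * (z u : ℂ)) ^ 2 =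
        (((1 - ∑ i, Complex.normSq (u i)) ^ 2 - (a - (- z u)) ^ 2 : ℝ) : ℂ) := by
      push_cast
      ring
    rw [this, Complex.norm_real, Real.norm_eq_abs]
  have hR' : (1 - H * H) * R = 1 := by
    refine Eq.trans ?_ hR
    simp
  have hinner : ∀ u : Fin d → ℂ,
      ENNReal.ofReal (q ^ k * (2 * (2 / 3) ^ k)) *
        ENNReal.ofReal (1 - ∑ i, Complex.normSq (u i)) ^ (2 * k + 1) ≤
      ∫⁻ a, Set.indicator {a : ℝ | ‖bordered H (T *ᵥ u) a‖ ≤ 1}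
        (fun a => ENNReal.ofReal (pairDet 1 (bordered H (T *ᵥ u) a) ^ k)) a := by
    intro u
    set s := 1 - ∑ i, Complex.normSq (u i) with hs
    rcases le_or_gt s 0 with h0 | h0
    · rw [ENNReal.ofReal_of_nonpos h0, zero_pow (by omega), mul_zero]
      exact zero_le
    have h1 := le_lintegral_sq_sub_sq_pow h0 (-z u) k
    rw [← ENNReal.ofReal_pow h0.le, ← ENNReal.ofReal_mul (by positivity), mul_assoc,
      ENNReal.ofReal_mul (by positivity)]
    refine (mul_le_mul_right h1 _).trans ?_
    rw [← lintegral_const_mul' _ _ ENNReal.ofReal_ne_top, ← lintegral_indicator measurableSet_Ioo]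
    refine lintegral_mono fun a => Set.indicator_le (fun a ha => ?_) a
    have h2 := ha.1
    have h3 := ha.2
    have hnn : 0 ≤ s ^ 2 - (a - -z u) ^ 2 := by nlinarith
    rw [Set.indicator_of_mem, hb, ← ENNReal.ofReal_mul (by positivity), ← mul_pow,
      abs_of_nonneg hnn]
    refine norm_bordered_le_one hH hn _ a _ _ hR' (hq u).1 (hq u).2 ?_ ?_ <;> linarith
  rw [lintegral_comp_mulVec hT, hdet]
  refine le_trans (le_of_eq ?_) (mul_le_mul_right (lintegral_mono hinner) _)
  rw [lintegral_const_mul' _ _ ENNReal.ofReal_ne_top, lintegral_pi_complex_sub_pow d 1 (by omega),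
    ENNReal.ofReal_one, one_pow, mul_one, ← ENNReal.ofReal_mul (by positivity),
    ← ENNReal.ofReal_mul (by positivity), ← ENNReal.ofReal_mul (by positivity)]
  congr 1
  ring

end Fibre

/-- The real vector space of Hermitian `d × d` matrices. -/
abbrev Herm (d : ℕ) : Type := selfAdjoint.submodule ℝ (Matrix (Fin d) (Fin d) ℂ)

instance (d : ℕ) : FiniteDimensional ℝ (Matrix (Fin d) (Fin d) ℂ) :=
  FiniteDimensional.complexToReal _

instance (d : ℕ) : MeasurableSpace (Herm d) := borel _

instance (d : ℕ) : BorelSpace (Herm d) := ⟨rfl⟩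

theorem Herm.isHermitian {d : ℕ} (H : Herm d) : (H : Matrix (Fin d) (Fin d) ℂ).IsHermitian := H.2

theorem norm_reindex_le_one {m n : Type*} [Fintype m] [DecidableEq m] [Fintype n] [DecidableEq n]
    (e : m ≃ n) {K : Matrix m m ℂ} (hK : ‖K‖ ≤ 1) : ‖reindex e e K‖ ≤ 1 := by
  refine norm_le_of_posSemidef zero_le_one ?_
  have h := (posSemidef_of_norm_le hK).submatrix e.symm
  convert h using 1
  simp [submatrix_sub, submatrix_mul_equiv, conjTranspose_submatrix]

theorem bordered_add {n : Type*} (H H' : Matrix n n ℂ) (v v' : n → ℂ) (a a' : ℝ) :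
    bordered (H + H') (v + v') (a + a') = bordered H v a + bordered H' v' a' := by
  rw [bordered, bordered, bordered, fromBlocks_add]
  congr 1
  · simp
  · simp

theorem bordered_smul {n : Type*} (c : ℝ) (H : Matrix n n ℂ) (v : n → ℂ) (a : ℝ) :
    bordered (c • H) (c • v) (c • a) = c • bordered H v a := by
  rw [bordered, bordered, fromBlocks_smul]
  congr 1
  · ext i j
    simp
  · ext i j
    fin_cases i; fin_cases j
    simp

/-- Decomposition of Hermitian matrices of size `d + 1` into a Hermitian block of size `d`,
a column and a real corner entry. -/
def borderEquiv (d : ℕ) : (Herm d × (Fin d → ℂ) × ℝ) ≃L[ℝ] Herm (d + 1) :=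
  LinearEquiv.toContinuousLinearEquiv <| LinearEquiv.ofBijective
    { toFun := fun p => ⟨reindex finSumFinEquiv finSumFinEquiv (bordered p.1 p.2.1 p.2.2),
        (isHermitian_bordered p.1.isHermitian p.2.1 p.2.2).submatrix _⟩
      map_add' := by
        intro p q
        ext1
        exact congrArg (reindex finSumFinEquiv finSumFinEquiv) (bordered_add _ _ _ _ _ _)
      map_smul' := by
        intro c p
        ext1
        exact congrArg (reindex finSumFinEquiv finSumFinEquiv) (bordered_smul _ _ _ _) }
    (by
      constructor
      · rintro ⟨H, v, a⟩ ⟨H', v', a'⟩ h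
        have h1 := (reindex finSumFinEquiv finSumFinEquiv).injective (congrArg Subtype.val h)
        rw [bordered, bordered, fromBlocks_inj] at h1
        obtain ⟨h2, h3, -, h4⟩ := h1
        refine Prod.ext (Subtype.ext h2) (Prod.ext (replicateCol_injective h3) ?_)
        have := congrFun (congrFun h4 0) 0
        simpa using this
      · intro K
        set B := (K : Matrix (Fin (d + 1)) (Fin (d + 1)) ℂ).submatrix finSumFinEquiv
          finSumFinEquiv with hB
        have hBh : B.IsHermitian := K.isHermitian.submatrix _
        refine ⟨⟨⟨B.toBlocks₁₁, ?_⟩, fun i => B (Sum.inl i) (Sum.inr 0),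
          (B (Sum.inr 0) (Sum.inr 0)).re⟩, ?_⟩
        · exact hBh.submatrix Sum.inl
        · ext1
          change reindex finSumFinEquiv finSumFinEquiv (bordered B.toBlocks₁₁ _ _) = K.1
          rw [← Equiv.eq_symm_apply]
          change _ = B
          ext i j
          rcases i with i | i <;> rcases j with j | j
          · rfl
          · fin_cases j
            rfl
          · fin_cases i
            exact hBh.apply _ _
          · fin_cases i; fin_cases j
            have := hBh.apply (Sum.inr 0) (Sum.inr 0)
            simpa [bordered] using Complex.conj_eq_iff_re.1 this)

theorem coe_borderEquiv {d : ℕ} (H : Herm d) (v : Fin d → ℂ) (a : ℝ) :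
    (borderEquiv d (H, v, a) : Matrix (Fin (d + 1)) (Fin (d + 1)) ℂ) =
      reindex finSumFinEquiv finSumFinEquiv (bordered H v a) := rfl

theorem exists_lintegral_border {d : ℕ} (μ : Measure (Herm (d + 1))) [μ.IsAddHaarMeasure] :
    ∃ c : ℝ≥0, ∀ F : Herm (d + 1) → ℝ≥0∞, Measurable F →
      ∫⁻ K, F K ∂μ = c * ∫⁻ H : Herm d, (∫⁻ v, ∫⁻ a, F (borderEquiv d (H, v, a)))
        ∂Measure.addHaar := by
  set ρ : Measure (Herm d × (Fin d → ℂ) × ℝ) := Measure.addHaar.prod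
    ((volume : Measure (Fin d → ℂ)).prod (volume : Measure ℝ)) with hρ
  have : ((volume : Measure (Fin d → ℂ)).prod (volume : Measure ℝ)).IsAddHaarMeasure :=
    Measure.prod.instIsAddHaarMeasure _ _
  have : ρ.IsAddHaarMeasure := Measure.prod.instIsAddHaarMeasure _ _
  have hmap : (ρ.map (borderEquiv d)).IsAddHaarMeasure :=
    (borderEquiv d).isAddHaarMeasure_map ρ
  refine ⟨μ.addHaarScalarFactor (ρ.map (borderEquiv d)), fun F hF => ?_⟩
  conv_lhs => rw [Measure.isAddLeftInvariant_eq_smul μ (ρ.map (borderEquiv d))]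
  have hme : Measurable (borderEquiv d) := (borderEquiv d).continuous.measurable
  rw [lintegral_smul_measure, lintegral_map hF hme, ENNReal.smul_def, smul_eq_mul]
  congr 1
  rw [hρ, lintegral_prod _ (by fun_prop)]
  refine lintegral_congr fun H => ?_
  rw [lintegral_prod _ (by fun_prop)]

theorem lintegral_inv_pairDet_succ_le {d : ℕ} {c : ℝ≥0} {μ : Measure (Herm (d + 1))}
    (hc : ∀ F : Herm (d + 1) → ℝ≥0∞, Measurable F →
      ∫⁻ K, F K ∂μ = c * ∫⁻ H : Herm d, (∫⁻ v, ∫⁻ a, F (borderEquiv d (H, v, a)))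
        ∂Measure.addHaar) :
    ∫⁻ K : Herm (d + 1), ENNReal.ofReal ((pairDet Complex.I K.1)⁻¹ ^ (d + 1)) ∂μ ≤
      c * (ENNReal.ofReal (Real.pi * (Real.pi ^ d * d.factorial / (d + d).factorial)) *
        ∫⁻ H : Herm d, ENNReal.ofReal ((pairDet Complex.I H.1)⁻¹ ^ d) ∂Measure.addHaar) := by
  have hm : Measurable fun K : Herm (d + 1) => pairDet Complex.I K.1 :=
    ((continuous_pairDet _).comp continuous_subtype_val).measurable
  rw [hc _ (by fun_prop), ← lintegral_const_mul' _ _ ENNReal.ofReal_ne_top]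
  refine mul_le_mul_right (lintegral_mono fun H => ?_) _
  simp only [coe_borderEquiv, pairDet_reindex]
  exact lintegral_fibre_inv_le H.isHermitian

theorem le_lintegral_pairDet_succ {d : ℕ} {c : ℝ≥0} {μ : Measure (Herm (d + 1))}
    (hc : ∀ F : Herm (d + 1) → ℝ≥0∞, Measurable F →
      ∫⁻ K, F K ∂μ = c * ∫⁻ H : Herm d, (∫⁻ v, ∫⁻ a, F (borderEquiv d (H, v, a)))
        ∂Measure.addHaar) (k : ℕ) :
    c * (ENNReal.ofReal (2 * (2 / 3) ^ k *
        (Real.pi ^ d * (2 * k + 1).factorial / (2 * k + 1 + d).factorial)) *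
        ∫⁻ H : Herm d in Metric.closedBall 0 1, ENNReal.ofReal (pairDet 1 H.1 ^ (k + 1))
          ∂Measure.addHaar) ≤
      ∫⁻ K : Herm (d + 1) in Metric.closedBall 0 1, ENNReal.ofReal (pairDet 1 K.1 ^ k) ∂μ := by
  have hm : Measurable fun K : Herm (d + 1) => pairDet 1 K.1 :=
    ((continuous_pairDet _).comp continuous_subtype_val).measurable
  have hball : (Metric.closedBall (0 : Herm d) 1 : Set (Herm d)) =ᵐ[Measure.addHaar]
      (Metric.ball (0 : Herm d) 1 : Set (Herm d)) := by
    rw [← Metric.ball_union_sphere]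
    exact union_ae_eq_left_of_ae_eq_empty
      (ae_eq_empty.2 (Measure.addHaar_sphere_of_ne_zero _ _ one_ne_zero))
  rw [setLIntegral_congr hball, ← lintegral_indicator measurableSet_closedBall,
    ← lintegral_indicator measurableSet_ball,
    hc _ (Measurable.indicator (by fun_prop) measurableSet_closedBall),
    ← lintegral_const_mul' _ _ ENNReal.ofReal_ne_top]
  refine mul_le_mul_right (lintegral_mono fun H => ?_) _
  by_cases hH : H ∈ Metric.ball (0 : Herm d) 1
  · rw [Set.indicator_of_mem hH]
    have hn : ‖H.1‖ < 1 := by simpa using hH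
    refine (le_lintegral_fibre H.isHermitian hn k).trans
      (lintegral_mono fun v => lintegral_mono fun a => ?_)
    by_cases ha : ‖bordered H.1 v a‖ ≤ 1
    · rw [Set.indicator_of_mem (by exact ha), Set.indicator_of_mem, coe_borderEquiv,
        pairDet_reindex]
      rw [mem_closedBall_zero_iff]
      exact norm_reindex_le_one _ ha
    · rw [Set.indicator_of_notMem (by exact ha)]
      exact zero_le
  · rw [Set.indicator_of_notMem hH, mul_zero]
    exact zero_le

/-- The constant comparing the Cayley weight with the unit ball of Hermitian matrices. -/
def ballConst : ℕ → ℕ → ℝ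
  | 0, _ => 1
  | d + 1, k => ballConst d (k + 1) *
      ((Real.pi * (Real.pi ^ d * d.factorial / (d + d).factorial)) /
        (2 * (2 / 3) ^ k * (Real.pi ^ d * (2 * k + 1).factorial / (2 * k + 1 + d).factorial)))

theorem ballConst_pos (d : ℕ) : ∀ k, 0 < ballConst d k := by
  induction d with
  | zero => intro k; simp [ballConst]
  | succ d ih =>
    intro k
    have := ih (k + 1)
    have := Real.pi_pos
    rw [ballConst]
    positivity

theorem lintegral_inv_pairDet_le (d : ℕ) : ∀ (k : ℕ) (μ : Measure (Herm d)) [μ.IsAddHaarMeasure],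
    ∫⁻ K : Herm d, ENNReal.ofReal ((pairDet Complex.I K.1)⁻¹ ^ d) ∂μ ≤
      ENNReal.ofReal (ballConst d k) *
        ∫⁻ K : Herm d in Metric.closedBall 0 1, ENNReal.ofReal (pairDet 1 K.1 ^ k) ∂μ := by
  induction d with
  | zero =>
    intro k μ _
    have h : (Metric.closedBall (0 : Herm 0) 1) = Set.univ := by
      refine Set.eq_univ_of_forall fun K => ?_
      rw [Subsingleton.elim K 0]
      simp
    simp [h, ballConst, pairDet]
  | succ d ih =>
    intro k μ _
    obtain ⟨c, hc⟩ := exists_lintegral_border μ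
    refine (lintegral_inv_pairDet_succ_le hc).trans ?_
    refine le_trans ?_ (mul_le_mul_right (le_lintegral_pairDet_succ hc k) _)
    have h := ih (k + 1) Measure.addHaar
    rw [mul_left_comm (ENNReal.ofReal (ballConst _ _))]
    refine mul_le_mul_right ((mul_le_mul_right h _).trans_eq ?_) (c : ℝ≥0∞)
    rw [← mul_assoc, ← mul_assoc, ← ENNReal.ofReal_mul (by positivity),
      ← ENNReal.ofReal_mul (ballConst_pos _ _).le]
    congr 2
    rw [ballConst]
    have := Real.pi_pos
    field_simp

theorem ballConst_mul_prod (d : ℕ) : ∀ k, ballConst d k *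
    ((∏ j ∈ Finset.range d, ((2 * j).factorial : ℝ)) *
      ∏ j ∈ Finset.range d, ((2 * (k + j) + 1).factorial : ℝ)) =
    (∏ j ∈ Finset.range d, (j.factorial : ℝ)) *
      (∏ j ∈ Finset.range d, ((2 * k + d + j).factorial : ℝ)) *
      ((Real.pi / 2) ^ d * ∏ j ∈ Finset.range d, (3 / 2 : ℝ) ^ (k + j)) := by
  induction d with
  | zero => intro k; simp [ballConst]
  | succ d ih =>
    intro k
    have h := ih (k + 1)
    rw [ballConst, Finset.prod_range_succ (fun j => ((2 * j).factorial : ℝ)),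
      Finset.prod_range_succ (fun j => (j.factorial : ℝ)),
      Finset.prod_range_succ' (fun j => ((2 * (k + j) + 1).factorial : ℝ)),
      Finset.prod_range_succ' (fun j => ((2 * k + (d + 1) + j).factorial : ℝ)),
      Finset.prod_range_succ' (fun j => (3 / 2 : ℝ) ^ (k + j))]
    have h1 : ∏ j ∈ Finset.range d, ((2 * (k + (j + 1)) + 1).factorial : ℝ) =
        ∏ j ∈ Finset.range d, ((2 * (k + 1 + j) + 1).factorial : ℝ) :=
      Finset.prod_congr rfl fun j _ => by
        rw [show 2 * (k + (j + 1)) + 1 = 2 * (k + 1 + j) + 1 by ring]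
    have h2 : ∏ j ∈ Finset.range d, ((2 * k + (d + 1) + (j + 1)).factorial : ℝ) =
        ∏ j ∈ Finset.range d, ((2 * (k + 1) + d + j).factorial : ℝ) :=
      Finset.prod_congr rfl fun j _ => by
        rw [show 2 * k + (d + 1) + (j + 1) = 2 * (k + 1) + d + j by ring]
    have h3 : ∏ j ∈ Finset.range d, (3 / 2 : ℝ) ^ (k + (j + 1)) =
        ∏ j ∈ Finset.range d, (3 / 2 : ℝ) ^ (k + 1 + j) :=
      Finset.prod_congr rfl fun j _ => by rw [show k + (j + 1) = k + 1 + j by ring]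
    have h4 : (2 / 3 : ℝ) ^ k = ((3 / 2 : ℝ) ^ k)⁻¹ := by rw [← inv_pow]; norm_num
    have hpi := Real.pi_pos
    have h5 : ((2 * k + 1).factorial : ℝ) ≠ 0 := by positivity
    have h6 : ((2 * d).factorial : ℝ) ≠ 0 := by positivity
    have h7 : (3 / 2 : ℝ) ^ k ≠ 0 := by positivity
    rw [h1, h2, h3, h4, show d + d = 2 * d by ring, add_zero, add_zero,
      show 2 * k + 1 + d = 2 * k + (d + 1) by ring, pow_succ (Real.pi / 2)]
    generalize ∏ j ∈ Finset.range d, (3 / 2 : ℝ) ^ (k + 1 + j) = P at *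
    generalize ∏ j ∈ Finset.range d, ((2 * (k + 1 + j) + 1).factorial : ℝ) = Q at *
    generalize ∏ j ∈ Finset.range d, ((2 * (k + 1) + d + j).factorial : ℝ) = R at *
    generalize (3 / 2 : ℝ) ^ k = t at *
    generalize (Real.pi / 2) ^ d = u at *
    field_simp
    linear_combination h

theorem prod_factorial_even_mul_odd (d : ℕ) :
    (∏ j ∈ Finset.range d, ((2 * j).factorial : ℝ)) *
      ∏ j ∈ Finset.range d, ((2 * j + 1).factorial : ℝ) =
    ∏ j ∈ Finset.range (d + d), (j.factorial : ℝ) := by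
  induction d with
  | zero => simp
  | succ d ih =>
    rw [Finset.prod_range_succ, Finset.prod_range_succ,
      show d + 1 + (d + 1) = d + d + 1 + 1 by ring,
      Finset.prod_range_succ, Finset.prod_range_succ, ← ih, two_mul]
    ring

theorem ballConst_zero_eq (d : ℕ) :
    ballConst d 0 = (Real.pi / 2) ^ d * ∏ j ∈ Finset.range d, (3 / 2 : ℝ) ^ j := by
  have h := ballConst_mul_prod d 0
  simp only [zero_add, mul_zero] at h
  rw [prod_factorial_even_mul_odd, ← Finset.prod_range_add (fun j => (j.factorial : ℝ)),
    mul_comm] at h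
  exact mul_left_cancel₀ (Finset.prod_ne_zero_iff.2 fun j _ => by positivity) h

theorem ballConst_zero_le {d : ℕ} (hd : 2 ≤ d) : ballConst d 0 ≤ (3 / 2) ^ d ^ 2 := by
  rw [ballConst_zero_eq]
  refine le_of_sq_le_sq ?_ (by positivity)
  have hs : 2 * ∑ j ∈ Finset.range d, j + d = d * d := by
    rw [mul_comm, Finset.sum_range_id_mul_two]
    obtain ⟨e, rfl⟩ : ∃ e, d = e + 1 := ⟨d - 1, by omega⟩
    simp
    ring
  rw [Finset.prod_pow_eq_pow_sum, mul_pow, ← pow_mul, ← pow_mul, ← pow_mul, mul_comm d 2,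
    pow_mul]
  have hpi : (Real.pi / 2) ^ 2 ≤ (3 / 2) ^ 3 := by
    have := Real.pi_lt_d2
    have := Real.pi_pos
    nlinarith
  calc ((Real.pi / 2) ^ 2) ^ d * (3 / 2 : ℝ) ^ ((∑ j ∈ Finset.range d, j) * 2)
      ≤ ((3 / 2) ^ 3) ^ d * (3 / 2) ^ ((∑ j ∈ Finset.range d, j) * 2) := by gcongr
    _ = (3 / 2 : ℝ) ^ (3 * d + (∑ j ∈ Finset.range d, j) * 2) := by rw [← pow_mul, ← pow_add]
    _ ≤ (3 / 2) ^ (d ^ 2 * 2) := by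
      refine pow_le_pow_right₀ (by norm_num) ?_
      nlinarith

/-- Decomposition of complex matrices into Hermitian and skew-Hermitian parts. -/
def cartesianEquiv (d : ℕ) : (Herm d × Herm d) ≃ₗ[ℝ] Matrix (Fin d) (Fin d) ℂ :=
  LinearEquiv.ofBijective
    { toFun := fun p => p.1.1 + Complex.I • p.2.1
      map_add' := fun p q => by
        simp only [Prod.fst_add, Prod.snd_add, Submodule.coe_add, smul_add]
        abel
      map_smul' := fun c p => by
        simp only [Prod.smul_fst, Prod.smul_snd, Submodule.coe_smul, smul_add, RingHom.id_apply]
        rw [smul_comm c Complex.I] }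
    (by
      constructor
      · rintro ⟨H, K⟩ ⟨H', K'⟩ h
        change H.1 + Complex.I • K.1 = H'.1 + Complex.I • K'.1 at h
        have h' := congrArg conjTranspose h
        simp only [conjTranspose_add, conjTranspose_smul, H.isHermitian.eq, K.isHermitian.eq,
          H'.isHermitian.eq, K'.isHermitian.eq, Complex.star_def, Complex.conj_I] at h'
        have h1 : (2 : ℂ) • H.1 = (2 : ℂ) • H'.1 := by
          linear_combination (norm := module) h + h'
        have h2 : (2 * Complex.I) • K.1 = (2 * Complex.I) • K'.1 := by
          linear_combination (norm := module) h - h'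
        exact Prod.ext (Subtype.ext (smul_right_injective _ two_ne_zero h1))
          (Subtype.ext (smul_right_injective _ (mul_ne_zero two_ne_zero Complex.I_ne_zero) h2))
      · intro A
        exact ⟨⟨⟨(realPart A).1, (realPart A).2⟩, ⟨(imaginaryPart A).1, (imaginaryPart A).2⟩⟩,
          realPart_add_I_smul_imaginaryPart A⟩)

theorem finrank_herm (d : ℕ) : Module.finrank ℝ (Herm d) = d ^ 2 := by
  have h := (cartesianEquiv d).finrank_eq
  have h2 := Module.finrank_mul_finrank ℝ ℂ (Matrix (Fin d) (Fin d) ℂ)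
  rw [Module.finrank_prod, ← h2, Module.finrank_matrix, Complex.finrank_real_complex] at h
  simp at h
  nlinarith

/-- The complex linear map `X ↦ Bᴴ X B`. -/
def congruence {d : ℕ} (B : Matrix (Fin d) (Fin d) ℂ) :
    Matrix (Fin d) (Fin d) ℂ →ₗ[ℂ] Matrix (Fin d) (Fin d) ℂ :=
  LinearMap.mulLeft ℂ Bᴴ ∘ₗ LinearMap.mulRight ℂ B

theorem det_congruence {d : ℕ} (B : Matrix (Fin d) (Fin d) ℂ) :
    LinearMap.det (congruence B) = (B.det * star B.det) ^ d := by
  let e : Matrix (Fin d) (Fin d) ℂ ≃ₗ[ℂ] (Fin d × Fin d → ℂ) :=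
    LinearEquiv.ofBijective
      { toFun := vec, map_add' := vec_add, map_smul' := vec_smul } vec_bijective
  rw [← LinearMap.det_conj _ e]
  have : (e.toLinearMap ∘ₗ congruence B ∘ₗ e.symm.toLinearMap) =
      Matrix.toLin' (kronecker Bᵀ Bᴴ) := by
    refine LinearMap.ext fun v => ?_
    obtain ⟨X, rfl⟩ := e.surjective v
    rw [toLin'_apply]
    change vec (Bᴴ * (e.symm (e X) * B)) = kronecker Bᵀ Bᴴ *ᵥ vec X
    rw [e.symm_apply_apply]
    erw [kronecker_mulVec_vec]
    rw [transpose_transpose, Matrix.mul_assoc]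
  erw [this]
  rw [LinearMap.det_toLin']
  erw [det_kronecker]
  simp [det_conjTranspose, mul_pow]

/-- The real linear map `H ↦ Bᴴ H B` on Hermitian matrices. -/
def hermCongruence {d : ℕ} (B : Matrix (Fin d) (Fin d) ℂ) : Herm d →ₗ[ℝ] Herm d where
  toFun H := ⟨Bᴴ * (H.1 * B), by
    rw [← Matrix.mul_assoc]
    exact isHermitian_conjTranspose_mul_mul B H.isHermitian⟩
  map_add' H K := by
    ext1
    simp [add_mul, mul_add]
  map_smul' c H := by
    ext1
    simp

theorem abs_det_hermCongruence {d : ℕ} (B : Matrix (Fin d) (Fin d) ℂ) :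
    |LinearMap.det (hermCongruence B)| = (‖B.det‖ ^ 2) ^ d := by
  have h : LinearMap.det ((congruence B).restrictScalars ℝ) =
      LinearMap.det (hermCongruence B) * LinearMap.det (hermCongruence B) := by
    rw [← LinearMap.det_prodMap, ← LinearMap.det_conj _ (cartesianEquiv d)]
    congr 1
    refine LinearMap.ext fun A => ?_
    obtain ⟨⟨H, K⟩, rfl⟩ := (cartesianEquiv d).surjective A
    simp only [LinearMap.comp_apply, LinearEquiv.coe_coe, LinearEquiv.symm_apply_apply]
    change Bᴴ * ((H.1 + Complex.I • K.1) * B) = Bᴴ * (H.1 * B) + Complex.I • (Bᴴ * (K.1 * B))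
    simp [add_mul, mul_add]
  rw [LinearMap.det_restrictScalars, det_congruence, Algebra.norm_complex_apply,
    Complex.normSq_eq_norm_sq] at h
  have h2 : ‖(B.det * star B.det) ^ d‖ = (‖B.det‖ ^ 2) ^ d := by
    rw [norm_pow, norm_mul, norm_star, sq]
  rw [h2, ← sq] at h
  rw [← abs_of_nonneg (show 0 ≤ (‖B.det‖ ^ 2) ^ d by positivity)]
  exact ((sq_eq_sq_iff_abs_eq_abs _ _).1 h).symm

section Moebius

variable {d : ℕ}

/-- Denominator of the action of `g` on Hermitian matrices through the Cayley transform. -/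
def moebiusDen (g H : Matrix (Fin d) (Fin d) ℂ) : Matrix (Fin d) (Fin d) ℂ :=
  (1 + Complex.I • H) + g * (1 - Complex.I • H)

/-- Numerator of the action of `g` on Hermitian matrices through the Cayley transform. -/
def moebiusNum (g H : Matrix (Fin d) (Fin d) ℂ) : Matrix (Fin d) (Fin d) ℂ :=
  -Complex.I • ((1 + Complex.I • H) - g * (1 - Complex.I • H))

theorem moebiusDen_add_num (g H : Matrix (Fin d) (Fin d) ℂ) :
    moebiusDen g H + Complex.I • moebiusNum g H = (2 : ℂ) • (1 + Complex.I • H) := by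
  rw [moebiusDen, moebiusNum, smul_smul, mul_neg, Complex.I_mul_I, neg_neg, one_smul]
  module

theorem moebiusDen_sub_num (g H : Matrix (Fin d) (Fin d) ℂ) :
    moebiusDen g H - Complex.I • moebiusNum g H = (2 : ℂ) • (g * (1 - Complex.I • H)) := by
  rw [moebiusDen, moebiusNum, smul_smul, mul_neg, Complex.I_mul_I, neg_neg, one_smul]
  module

theorem conjTranspose_one_add_I_smul {H : Matrix (Fin d) (Fin d) ℂ} (hH : H.IsHermitian) :
    (1 + Complex.I • H)ᴴ = 1 - Complex.I • H := by
  simp [hH.eq, sub_eq_add_neg]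

theorem conjTranspose_one_sub_I_smul {H : Matrix (Fin d) (Fin d) ℂ} (hH : H.IsHermitian) :
    (1 - Complex.I • H)ᴴ = 1 + Complex.I • H := by
  simp [hH.eq]

theorem one_add_I_smul_mul (H : Matrix (Fin d) (Fin d) ℂ) :
    (1 + Complex.I • H) * (1 - Complex.I • H) = 1 + H * H := by
  simp only [add_mul, mul_sub, mul_one, one_mul, smul_mul_smul_comm, Complex.I_mul_I]
  module

theorem one_sub_I_smul_mul (H : Matrix (Fin d) (Fin d) ℂ) :
    (1 - Complex.I • H) * (1 + Complex.I • H) = 1 + H * H := by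
  simp only [sub_mul, mul_add, mul_one, one_mul, smul_mul_smul_comm, Complex.I_mul_I]
  module

theorem isUnit_det_one_add_I_smul {H : Matrix (Fin d) (Fin d) ℂ} (hH : H.IsHermitian) :
    IsUnit (1 + Complex.I • H).det := by
  have h := (posDef_one_add_mul_self hH).isUnit
  rw [← one_add_I_smul_mul, isUnit_iff_isUnit_det, det_mul] at h
  exact isUnit_of_mul_isUnit_left h

theorem moebius_isHermitian {g H : Matrix (Fin d) (Fin d) ℂ} (hg : gᴴ * g = 1)
    (hH : H.IsHermitian) (hD : IsUnit (moebiusDen g H).det) :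
    (moebiusNum g H * (moebiusDen g H)⁻¹).IsHermitian := by
  have key : (moebiusDen g H)ᴴ * moebiusNum g H = (moebiusNum g H)ᴴ * moebiusDen g H := by
    rw [moebiusDen, moebiusNum]
    simp only [conjTranspose_add, conjTranspose_sub, conjTranspose_smul, conjTranspose_mul,
      conjTranspose_one, hH.eq, Complex.star_def, map_neg, Complex.conj_I, neg_neg]
    have h1 := one_add_I_smul_mul H
    have h2 := one_sub_I_smul_mul H
    have e1 : (1 + -Complex.I • H) = 1 - Complex.I • H := by module
    have e2 : (1 - -Complex.I • H) = 1 + Complex.I • H := by module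
    rw [e1, e2]
    generalize 1 + Complex.I • H = P at *
    generalize 1 - Complex.I • H = Q at *
    have h3 : Q * P = P * Q := h2.trans h1.symm
    have h4 : P * gᴴ * (g * Q) = P * Q := by
      rw [Matrix.mul_assoc, ← Matrix.mul_assoc gᴴ, hg, Matrix.one_mul]
    simp only [Matrix.mul_smul, Matrix.smul_mul, add_mul, mul_sub, sub_mul, mul_add, h3, h4]
    module
  have hD' : IsUnit (moebiusDen g H)ᴴ.det := by
    rw [det_conjTranspose]
    exact hD.star
  rw [IsHermitian, conjTranspose_mul, conjTranspose_nonsing_inv]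
  calc (moebiusDen g H)ᴴ⁻¹ * (moebiusNum g H)ᴴ
      = (moebiusDen g H)ᴴ⁻¹ * ((moebiusNum g H)ᴴ * moebiusDen g H) * (moebiusDen g H)⁻¹ := by
        rw [← Matrix.mul_assoc, mul_nonsing_inv_cancel_right _ _ hD]
    _ = _ := by rw [← key, nonsing_inv_mul_cancel_left _ _ hD']

/-- Equal images under two Möbius maps give equal translates of the Cayley transforms. -/
theorem exists_of_moebius_eq {g H g' H' : Matrix (Fin d) (Fin d) ℂ}
    (hD : IsUnit (moebiusDen g H).det) (hD' : IsUnit (moebiusDen g' H').det)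
    (h : moebiusNum g H * (moebiusDen g H)⁻¹ = moebiusNum g' H' * (moebiusDen g' H')⁻¹) :
    ∃ X, 1 + Complex.I • H' = (1 + Complex.I • H) * X ∧
      g' * (1 - Complex.I • H') = g * (1 - Complex.I • H) * X := by
  refine ⟨(moebiusDen g H)⁻¹ * moebiusDen g' H', ?_⟩
  have h1 : moebiusDen g' H' = moebiusDen g H * ((moebiusDen g H)⁻¹ * moebiusDen g' H') :=
    (mul_nonsing_inv_cancel_left _ _ hD).symm
  have h2 : moebiusNum g' H' = moebiusNum g H * ((moebiusDen g H)⁻¹ * moebiusDen g' H') := by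
    rw [← Matrix.mul_assoc, h, nonsing_inv_mul_cancel_right _ _ hD']
  generalize (moebiusDen g H)⁻¹ * moebiusDen g' H' = X at *
  have h3 := moebiusDen_add_num g' H'
  have h4 := moebiusDen_sub_num g' H'
  rw [h1, h2, ← Matrix.smul_mul, ← add_mul, moebiusDen_add_num, Matrix.smul_mul] at h3
  rw [h1, h2, ← Matrix.smul_mul, ← sub_mul, moebiusDen_sub_num, Matrix.smul_mul] at h4
  exact ⟨smul_right_injective _ two_ne_zero h3.symm, smul_right_injective _ two_ne_zero h4.symm⟩

/-- The Hermitian part of a matrix. -/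
def hermPart (d : ℕ) : Matrix (Fin d) (Fin d) ℂ →L[ℝ] Herm d :=
  LinearMap.toContinuousLinearMap
    { toFun := fun A => ⟨(realPart A).1, (realPart A).2⟩
      map_add' := fun A B => by ext1; simp
      map_smul' := fun c A => by ext1; simp }

theorem coe_hermPart {A : Matrix (Fin d) (Fin d) ℂ} (hA : A.IsHermitian) :
    (hermPart d A).1 = A :=
  IsSelfAdjoint.coe_realPart hA

/-- The action of `g` on Hermitian matrices through the Cayley transform. -/
def moebius (g : Matrix (Fin d) (Fin d) ℂ) (H : Herm d) : Herm d :=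
  hermPart d (moebiusNum g H.1 * (moebiusDen g H.1)⁻¹)

theorem coe_moebius {g : Matrix (Fin d) (Fin d) ℂ} (hg : gᴴ * g = 1) {H : Herm d}
    (hD : IsUnit (moebiusDen g H.1).det) :
    (moebius g H).1 = moebiusNum g H.1 * (moebiusDen g H.1)⁻¹ :=
  coe_hermPart (moebius_isHermitian hg H.isHermitian hD)

theorem injOn_moebius {g : Matrix (Fin d) (Fin d) ℂ} (hg : gᴴ * g = 1) :
    Set.InjOn (moebius g) {H : Herm d | IsUnit (moebiusDen g H.1).det} := by
  intro H hH K hK h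
  have h' := congrArg Subtype.val h
  rw [coe_moebius hg hH, coe_moebius hg hK] at h'
  obtain ⟨X, h1, h2⟩ := exists_of_moebius_eq hH hK h'
  have h3 : 1 - Complex.I • K.1 = (1 - Complex.I • H.1) * X := by
    have := congrArg (gᴴ * ·) h2
    simpa only [← Matrix.mul_assoc, hg, Matrix.one_mul] using this
  have h4 : (2 : ℂ) • (1 : Matrix (Fin d) (Fin d) ℂ) = (2 : ℂ) • X := by
    have := congrArg₂ (· + ·) h1 h3
    simp only [← add_mul] at this
    calc (2 : ℂ) • (1 : Matrix (Fin d) (Fin d) ℂ)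
        = 1 + Complex.I • K.1 + (1 - Complex.I • K.1) := by module
      _ = (1 + Complex.I • H.1 + (1 - Complex.I • H.1)) * X := this
      _ = ((2 : ℂ) • (1 : Matrix (Fin d) (Fin d) ℂ)) * X := by congr 1; module
      _ = _ := by rw [Matrix.smul_mul, Matrix.one_mul]
  have h5 : 1 = X := smul_right_injective _ two_ne_zero h4
  rw [← h5, Matrix.mul_one, add_right_inj] at h1
  exact Subtype.ext (smul_right_injective _ Complex.I_ne_zero h1.symm)

theorem pairDet_moebius {g : Matrix (Fin d) (Fin d) ℂ} (hg : gᴴ * g = 1) {H : Herm d}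
    (hD : IsUnit (moebiusDen g H.1).det) :
    pairDet Complex.I (moebius g H).1 * ‖(moebiusDen g H.1).det‖ ^ 2 =
      4 ^ d * pairDet Complex.I H.1 := by
  have h1 := moebiusDen_add_num g H.1
  have h2 := moebiusDen_sub_num g H.1
  have h3 : moebiusNum g H.1 = (moebius g H).1 * moebiusDen g H.1 := by
    rw [coe_moebius hg hD, nonsing_inv_mul_cancel_right _ _ hD]
  have hg1 : ‖g.det‖ = 1 := by
    have := congrArg (fun A => ‖det A‖) hg
    simp only [det_mul, det_conjTranspose, norm_mul, norm_star, det_one, norm_one] at this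
    nlinarith [norm_nonneg g.det]
  have h4 : (1 + Complex.I • (moebius g H).1) * moebiusDen g H.1 =
      (2 : ℂ) • (1 + Complex.I • H.1) := by
    rw [← h1, h3, add_mul, Matrix.one_mul, Matrix.smul_mul, ← h3]
  have h5 : (1 - Complex.I • (moebius g H).1) * moebiusDen g H.1 =
      (2 : ℂ) • (g * (1 - Complex.I • H.1)) := by
    rw [← h2, h3, sub_mul, Matrix.one_mul, Matrix.smul_mul, ← h3]
  have h6 := congrArg (fun A => ‖det A‖) h4
  have h7 := congrArg (fun A => ‖det A‖) h5
  simp only [det_mul, det_smul, norm_mul, norm_pow, Fintype.card_fin, hg1, one_mul,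
    Complex.norm_ofNat] at h6 h7
  simp only [pairDet, norm_mul]
  rw [show (4 : ℝ) = 2 * 2 by norm_num, mul_pow]
  linear_combination ‖(1 - Complex.I • (moebius g H).1).det‖ * ‖(moebiusDen g H.1).det‖ * h6 +
    2 ^ d * ‖(1 + Complex.I • H.1).det‖ * h7

theorem hasFDerivAt_moebiusDen (g : Matrix (Fin d) (Fin d) ℂ) (H : Herm d) :
    ∃ L : Herm d →L[ℝ] Matrix (Fin d) (Fin d) ℂ,
      (∀ K : Herm d, L K = Complex.I • K.1 - g * Complex.I • K.1) ∧
      HasFDerivAt (fun K : Herm d => moebiusDen g K.1) L H := by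
  let L : Herm d →L[ℝ] Matrix (Fin d) (Fin d) ℂ := LinearMap.toContinuousLinearMap
    { toFun := fun K => Complex.I • K.1 - g * Complex.I • K.1
      map_add' := fun A B => by simp [mul_add]; abel
      map_smul' := fun c A => by simp [smul_sub, smul_comm c] }
  have hL : ∀ K : Herm d, L K = Complex.I • K.1 - g * Complex.I • K.1 := fun K => rfl
  refine ⟨L, hL, ?_⟩
  have h : (fun K : Herm d => moebiusDen g K.1) = fun K => (1 + g) + L K := by
    funext K
    rw [hL, moebiusDen, mul_sub, Matrix.mul_one]
    abel
  rw [h]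
  exact L.hasFDerivAt.const_add _

theorem hasFDerivAt_moebiusNum (g : Matrix (Fin d) (Fin d) ℂ) (H : Herm d) :
    ∃ L : Herm d →L[ℝ] Matrix (Fin d) (Fin d) ℂ,
      (∀ K : Herm d, L K = K.1 + g * K.1) ∧
      HasFDerivAt (fun K : Herm d => moebiusNum g K.1) L H := by
  let L : Herm d →L[ℝ] Matrix (Fin d) (Fin d) ℂ := LinearMap.toContinuousLinearMap
    { toFun := fun K => K.1 + g * K.1
      map_add' := fun A B => by simp [mul_add]; abel
      map_smul' := fun c A => by simp }
  have hL : ∀ K : Herm d, L K = K.1 + g * K.1 := fun K => rfl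
  refine ⟨L, hL, ?_⟩
  have h : (fun K : Herm d => moebiusNum g K.1) = fun K => -Complex.I • (1 - g) + L K := by
    funext K
    rw [hL, moebiusNum]
    simp only [mul_sub, Matrix.mul_one, Matrix.mul_smul, smul_add, smul_sub, smul_smul, neg_mul,
      Complex.I_mul_I, neg_neg, one_smul]
    abel
  rw [h]
  exact L.hasFDerivAt.const_add _

theorem moebius_deriv_eq {g : Matrix (Fin d) (Fin d) ℂ} (hg : gᴴ * g = 1) {H : Herm d}
    (hD : IsUnit (moebiusDen g H.1).det) (K : Matrix (Fin d) (Fin d) ℂ) :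
    (K + g * K) * (moebiusDen g H.1)⁻¹ - moebiusNum g H.1 * ((moebiusDen g H.1)⁻¹ *
      (Complex.I • K - g * Complex.I • K) * (moebiusDen g H.1)⁻¹) =
    ((2 : ℂ) • (moebiusDen g H.1)⁻¹)ᴴ * (K * ((2 : ℂ) • (moebiusDen g H.1)⁻¹)) := by
  have h1 := moebiusDen_add_num g H.1
  have h2 := moebiusDen_sub_num g H.1
  have hF := moebius_isHermitian hg H.isHermitian hD
  have hD' : IsUnit (moebiusDen g H.1)ᴴ.det := by
    rw [det_conjTranspose]
    exact hD.star
  have hN : moebiusNum g H.1 = (moebiusNum g H.1 * (moebiusDen g H.1)⁻¹) * moebiusDen g H.1 := by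
    rw [nonsing_inv_mul_cancel_right _ _ hD]
  rw [hN] at h1 h2
  have h1' := congrArg conjTranspose h1
  have h2' := congrArg conjTranspose h2
  rw [← Matrix.mul_assoc (moebiusNum g H.1), ← Matrix.mul_assoc (moebiusNum g H.1)]
  generalize moebiusNum g H.1 * (moebiusDen g H.1)⁻¹ = F at *
  generalize moebiusDen g H.1 = D at *
  simp only [conjTranspose_add, conjTranspose_sub, conjTranspose_smul, conjTranspose_mul,
    conjTranspose_one, hF.eq, H.isHermitian.eq, Complex.star_def, Complex.conj_I, map_ofNat]
    at h1' h2'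
  have key : Dᴴ * (1 + g - Complex.I • (F * (1 - g))) = (4 : ℂ) • 1 := by
    have h3 := congrArg (· * g) h2'
    simp only [Matrix.smul_mul, sub_mul, Matrix.mul_assoc, hg, Matrix.mul_one] at h3
    calc Dᴴ * (1 + g - Complex.I • (F * (1 - g)))
        = (Dᴴ + -Complex.I • (Dᴴ * F)) + (Dᴴ * g - -Complex.I • (Dᴴ * (F * g))) := by
          simp only [mul_add, mul_sub, Matrix.mul_smul, Matrix.mul_one]
          module
      _ = _ := by
          rw [h1', h3]
          module
  have hB : 1 + g - Complex.I • (F * (1 - g)) = (4 : ℂ) • (D⁻¹)ᴴ := by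
    have := congrArg ((Dᴴ)⁻¹ * ·) key
    simp only [nonsing_inv_mul_cancel_left _ _ hD', Matrix.mul_smul, Matrix.mul_one] at this
    rw [this, conjTranspose_nonsing_inv]
  calc (K + g * K) * D⁻¹ - F * (Complex.I • K - g * Complex.I • K) * D⁻¹
      = (1 + g - Complex.I • (F * (1 - g))) * K * D⁻¹ := by
        simp only [mul_sub, add_mul, sub_mul, Matrix.mul_smul, Matrix.smul_mul, Matrix.mul_one,
          Matrix.one_mul, Matrix.mul_assoc, smul_sub]
    _ = _ := by
        rw [hB]
        simp only [conjTranspose_smul, Matrix.mul_smul, Matrix.smul_mul, smul_smul,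
          Matrix.mul_assoc]
        norm_num

theorem hasFDerivAt_moebius {g : Matrix (Fin d) (Fin d) ℂ} (hg : gᴴ * g = 1) {H : Herm d}
    (hD : IsUnit (moebiusDen g H.1).det) :
    HasFDerivAt (moebius g)
      (LinearMap.toContinuousLinearMap (hermCongruence ((2 : ℂ) • (moebiusDen g H.1)⁻¹))) H := by
  obtain ⟨L, hL, hLd⟩ := hasFDerivAt_moebiusDen g H
  obtain ⟨N, hN, hNd⟩ := hasFDerivAt_moebiusNum g H
  have hDu : IsUnit (moebiusDen g H.1) := (isUnit_iff_isUnit_det _).2 hD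
  have hi := hasFDerivAt_ringInverse (𝕜 := ℝ) hDu.unit
  have hc := hi.comp H hLd
  have hp := (hermPart d).hasFDerivAt.comp H (hNd.mul' hc)
  have hf : moebius g = hermPart d ∘ ((fun K : Herm d => moebiusNum g K.1) *
      (Ring.inverse ∘ fun K : Herm d => moebiusDen g K.1)) := by
    funext K
    simp [moebius, nonsing_inv_eq_ringInverse]
  rw [hf]
  refine hp.congr_fderiv ?_
  refine ContinuousLinearMap.ext fun K => ?_
  ext1
  refine Eq.trans (congrArg (fun A => (hermPart d A).1) ?_)
    (coe_hermPart (hermCongruence ((2 : ℂ) • (moebiusDen g H.1)⁻¹) K).isHermitian)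
  refine Eq.trans ?_ (moebius_deriv_eq hg hD K.1)
  simp [hL, hN, nonsing_inv_eq_ringInverse]
  rw [add_mul, neg_add_eq_sub]

end Moebius

theorem finite_setOf_det_add_smul_eq_zero {d : ℕ} (A : Matrix (Fin d) (Fin d) ℂ)
    {B : Matrix (Fin d) (Fin d) ℂ} (hB : IsUnit B.det) :
    {z : ℂ | (A + z • B).det = 0}.Finite := by
  refine Set.Finite.subset
    (Polynomial.finite_setOfPred_isRoot (charpoly_monic (-(B⁻¹ * A))).ne_zero)
    fun z hz => ?_
  have h : A + z • B = B * (Matrix.scalar (Fin d) z - -(B⁻¹ * A)) := by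
    rw [sub_neg_eq_add, mul_add, mul_nonsing_inv_cancel_left _ _ hB, add_comm]
    congr 1
    ext i j
    simp [mul_comm]
  have hz' : (A + z • B).det = 0 := hz
  rw [h, det_mul] at hz'
  exact (eval_charpoly _ _).trans ((mul_eq_zero.1 hz').resolve_left hB.ne_zero)

theorem infinite_unit_sphere : (Metric.sphere (0 : ℂ) 1).Infinite := by
  have h : IsPreconnected (Metric.sphere (0 : ℂ) 1) :=
    isPreconnected_sphere (by rw [Complex.rank_real_complex]; norm_num) 0 1
  refine h.infinite_of_nontrivial ⟨1, by simp, -1, by simp, ?_⟩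
  norm_num [Complex.ext_iff]

theorem exists_phase {d : ℕ} {ι : Type*} [Finite ι] {g : ι → Matrix (Fin d) (Fin d) ℂ}
    (hg : ∀ i, (g i)ᴴ * g i = 1) :
    ∃ z : ℂ, ‖z‖ = 1 ∧ ∀ i, IsUnit (1 - z • g i).det := by
  have hfin : (⋃ i, {z : ℂ | (1 + z • -g i).det = 0}).Finite := by
    refine Set.finite_iUnion fun i => finite_setOf_det_add_smul_eq_zero _ ?_
    refine (isUnit_iff_isUnit_det _).1 (IsUnit.neg ?_)
    exact (isUnit_iff_isUnit_det _).2 (isUnit_det_of_left_inverse (hg i))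
  obtain ⟨z, hz, hz'⟩ := (infinite_unit_sphere.sdiff hfin).nonempty
  refine ⟨z, by simpa using hz, fun i => isUnit_iff_ne_zero.2 fun h => hz' ?_⟩
  refine Set.mem_iUnion.2 ⟨i, ?_⟩
  rw [Set.mem_ofPred_eq, smul_neg, ← sub_eq_add_neg]
  exact h

theorem ae_isUnit_det_moebiusDen {d : ℕ} {g : Matrix (Fin d) (Fin d) ℂ}
    (hg : IsUnit (1 - g).det) (μ : Measure (Herm d)) [μ.IsAddHaarMeasure] :
    ∀ᵐ H : Herm d ∂μ, IsUnit (moebiusDen g H.1).det := by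
  let L : ℝ →ₗ[ℝ] Herm d := LinearMap.toSpanSingleton ℝ _ ⟨1, isHermitian_one⟩
  have hs : MeasurableSet {H : Herm d | IsUnit (moebiusDen g H.1).det} := by
    simp only [isUnit_iff_ne_zero]
    refine IsOpen.measurableSet (isOpen_ne_fun ?_ continuous_const)
    unfold moebiusDen
    fun_prop
  refine ae_mem_of_ae_add_linearMap_mem L volume μ hs fun H => ?_
  have hu : IsUnit (Complex.I • (1 - g)).det := by
    rw [det_smul]
    exact (isUnit_iff_ne_zero.2 (pow_ne_zero _ Complex.I_ne_zero)).mul hg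
  have hf := (finite_setOf_det_add_smul_eq_zero (moebiusDen g H.1) hu).preimage
    (Complex.ofReal_injective.injOn)
  filter_upwards [hf.countable.ae_notMem volume] with s hs'
  change IsUnit (moebiusDen g (H + L s).1).det
  rw [isUnit_iff_ne_zero]
  intro h0
  refine hs' ?_
  rw [Set.mem_preimage, Set.mem_ofPred_eq, ← h0]
  congr 1
  have hL : (H + L s).1 = H.1 + (s : ℂ) • 1 := by
    change H.1 + s • (1 : Matrix (Fin d) (Fin d) ℂ) = _
    rw [Complex.coe_smul]
  rw [hL, moebiusDen, moebiusDen]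
  simp only [smul_add, mul_add, mul_sub, smul_sub, Matrix.mul_smul, Matrix.mul_one,
    smul_comm _ Complex.I]
  module

/-- The density of the push-forward of Haar measure under the Cayley transform. -/
def cayleyWeight {d : ℕ} (H : Herm d) : ℝ≥0∞ := ENNReal.ofReal ((pairDet Complex.I H.1)⁻¹ ^ d)

theorem lintegral_image_moebius {d : ℕ} {g : Matrix (Fin d) (Fin d) ℂ} (hg : gᴴ * g = 1)
    (μ : Measure (Herm d)) [μ.IsAddHaarMeasure] {s : Set (Herm d)} (hs : MeasurableSet s)
    (hD : ∀ H ∈ s, IsUnit (moebiusDen g H.1).det) :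
    ∫⁻ H in moebius g '' s, cayleyWeight H ∂μ = ∫⁻ H in s, cayleyWeight H ∂μ := by
  rw [lintegral_image_eq_lintegral_abs_det_fderiv_mul μ hs
    (fun H hH => (hasFDerivAt_moebius hg (hD H hH)).hasFDerivWithinAt)
    ((injOn_moebius hg).mono hD)]
  refine setLIntegral_congr_fun hs fun H hH => ?_
  have hD' := (hD H hH).ne_zero
  have h := pairDet_moebius hg (hD H hH)
  have hdet : |(LinearMap.toContinuousLinearMap
      (hermCongruence ((2 : ℂ) • (moebiusDen g H.1)⁻¹))).det| =
      (4 ^ d * (‖(moebiusDen g H.1).det‖ ^ 2)⁻¹) ^ d := by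
    rw [LinearMap.det_toContinuousLinearMap, abs_det_hermCongruence, det_smul, det_nonsing_inv,
      Ring.inverse_eq_inv', norm_mul, norm_pow, norm_inv, Fintype.card_fin, Complex.norm_ofNat,
      mul_pow, inv_pow, ← pow_mul, mul_comm d 2, pow_mul]
    norm_num
  have hn : ‖(moebiusDen g H.1).det‖ ^ 2 ≠ 0 := by positivity
  rw [hdet, cayleyWeight, cayleyWeight, ← ENNReal.ofReal_mul (by positivity), ← mul_pow]
  congr 2
  have h4 : (4 : ℝ) ^ d ≠ 0 := by positivity
  calc 4 ^ d * (‖(moebiusDen g H.1).det‖ ^ 2)⁻¹ * (pairDet Complex.I (moebius g H).1)⁻¹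
      = 4 ^ d * (pairDet Complex.I (moebius g H).1 * ‖(moebiusDen g H.1).det‖ ^ 2)⁻¹ := by
        rw [mul_inv]; ring
    _ = _ := by rw [h, mul_inv, mul_inv_cancel_left₀ h4]

theorem norm_le_one_of_conjTranspose_mul_self {d : ℕ} {U : Matrix (Fin d) (Fin d) ℂ}
    (hU : Uᴴ * U = 1) : ‖U‖ ≤ 1 := by
  refine norm_le_of_posSemidef zero_le_one ?_
  rw [hU, one_pow, one_smul, sub_self]
  exact PosSemidef.zero

theorem cayley_conjTranspose_mul_self {d : ℕ} {H : Matrix (Fin d) (Fin d) ℂ}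
    (hH : H.IsHermitian) :
    ((1 - Complex.I • H) * (1 + Complex.I • H)⁻¹)ᴴ *
      ((1 - Complex.I • H) * (1 + Complex.I • H)⁻¹) = 1 := by
  have hP := isUnit_det_one_add_I_smul hH
  have hP' : IsUnit (1 - Complex.I • H).det := by
    rw [← conjTranspose_one_add_I_smul hH, det_conjTranspose]
    exact hP.star
  rw [conjTranspose_mul, conjTranspose_nonsing_inv, conjTranspose_one_add_I_smul hH,
    conjTranspose_one_sub_I_smul hH, Matrix.mul_assoc,
    ← Matrix.mul_assoc _ _ (1 + Complex.I • H)⁻¹, one_add_I_smul_mul, ← one_sub_I_smul_mul,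
    mul_nonsing_inv_cancel_right _ _ hP, nonsing_inv_mul _ hP']

theorem norm_cayley_sub_le {d : ℕ} {H : Matrix (Fin d) (Fin d) ℂ} (hH : H.IsHermitian) {t : ℝ}
    (ht0 : 0 ≤ t) (ht : t ≤ 1) (hHt : ‖H‖ ≤ t) :
    ‖(1 - Complex.I • H) * (1 + Complex.I • H)⁻¹ - ((1 - t ^ 2) / (1 + t ^ 2) : ℝ) • 1‖ ≤
      2 * t / (1 + t ^ 2) := by
  have hP := isUnit_det_one_add_I_smul hH
  have hP' : IsUnit (1 + Complex.I • H)ᴴ.det := by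
    rw [det_conjTranspose]
    exact hP.star
  refine norm_le_of_posSemidef (by positivity) ?_
  set P := 1 + Complex.I • H with hPdef
  set Q := 1 - Complex.I • H with hQdef
  have hPQ : Pᴴ = Q := conjTranspose_one_add_I_smul hH
  have hQP : Qᴴ = P := conjTranspose_one_sub_I_smul hH
  set c : ℝ := (1 - t ^ 2) / (1 + t ^ 2) with hc
  have hZ := (posSemidef_of_norm_le hHt).smul
    (show 0 ≤ 4 * (1 - t ^ 2) / (1 + t ^ 2) ^ 2 by
      have : 0 ≤ 1 - t ^ 2 := by nlinarith
      positivity)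
  convert hZ.conjTranspose_mul_mul_same P⁻¹ using 1
  rw [conjTranspose_nonsing_inv]
  have e1 : Q * P⁻¹ - c • 1 = (Q - c • P) * P⁻¹ := by
    rw [sub_mul Q (c • P), Matrix.smul_mul, mul_nonsing_inv _ hP]
  have e2 : ((2 * t / (1 + t ^ 2)) ^ 2 : ℝ) • (1 : Matrix (Fin d) (Fin d) ℂ) =
      Pᴴ⁻¹ * (((2 * t / (1 + t ^ 2)) ^ 2 : ℝ) • (Q * P)) * P⁻¹ := by
    rw [hPQ] at hP' ⊢
    rw [Matrix.mul_smul, Matrix.smul_mul, nonsing_inv_mul_cancel_left _ _ hP', mul_nonsing_inv _ hP]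
  rw [e1, conjTranspose_mul, conjTranspose_nonsing_inv, Matrix.mul_assoc,
    ← Matrix.mul_assoc _ _ P⁻¹, ← Matrix.mul_assoc, e2, ← sub_mul, ← mul_sub]
  congr 2
  rw [conjTranspose_sub, conjTranspose_smul, hQP, hPQ, hH.eq, star_trivial]
  have hq : Q * P = 1 + H * H := one_sub_I_smul_mul H
  have hp : P * Q = 1 + H * H := one_add_I_smul_mul H
  have hpp : P * P = 1 - H * H + (2 : ℝ) • Complex.I • H := by
    simp only [hPdef, add_mul, mul_add, Matrix.mul_one, Matrix.one_mul, smul_mul_smul_comm,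
      Complex.I_mul_I]
    module
  have hqq : Q * Q = 1 - H * H - (2 : ℝ) • Complex.I • H := by
    simp only [hQdef, sub_mul, mul_sub, Matrix.mul_one, Matrix.one_mul, smul_mul_smul_comm,
      Complex.I_mul_I]
    module
  simp only [sub_mul, mul_sub, Matrix.smul_mul, Matrix.mul_smul, hq, hp, hpp, hqq]
  have ht2 : (1 + t ^ 2) ≠ 0 := by positivity
  rw [hc]
  match_scalars <;> field_simp <;> ring

theorem norm_sub_le_of_moebius_eq {d : ℕ} {g g' : Matrix (Fin d) (Fin d) ℂ} (hg : gᴴ * g = 1)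
    (hg' : g'ᴴ * g' = 1) {H H' : Herm d} (hD : IsUnit (moebiusDen g H.1).det)
    (hD' : IsUnit (moebiusDen g' H'.1).det) (h : moebius g H = moebius g' H') {t : ℝ}
    (ht0 : 0 ≤ t) (ht : t ≤ 1) (hH : ‖H.1‖ ≤ t) (hH' : ‖H'.1‖ ≤ t) :
    ‖g - g'‖ ≤ 4 * t / (1 + t ^ 2) := by
  have h1 := congrArg Subtype.val h
  rw [coe_moebius hg hD, coe_moebius hg' hD'] at h1
  obtain ⟨X, h2, h3⟩ := exists_of_moebius_eq hD hD' h1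
  have hP := isUnit_det_one_add_I_smul H.isHermitian
  have hP' := isUnit_det_one_add_I_smul H'.isHermitian
  have hX : IsUnit X.det := by
    rw [h2, det_mul] at hP'
    exact isUnit_of_mul_isUnit_right hP'
  have h4 : g' * ((1 - Complex.I • H'.1) * (1 + Complex.I • H'.1)⁻¹) =
      g * ((1 - Complex.I • H.1) * (1 + Complex.I • H.1)⁻¹) := by
    rw [← Matrix.mul_assoc, h3, h2, Matrix.mul_inv_rev, ← Matrix.mul_assoc,
      mul_nonsing_inv_cancel_right _ _ hX, Matrix.mul_assoc]
  have hC := cayley_conjTranspose_mul_self H.isHermitian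
  have hn := norm_cayley_sub_le H.isHermitian ht0 ht hH
  have hn' := norm_cayley_sub_le H'.isHermitian ht0 ht hH'
  generalize (1 - Complex.I • H.1) * (1 + Complex.I • H.1)⁻¹ = C at *
  generalize (1 - Complex.I • H'.1) * (1 + Complex.I • H'.1)⁻¹ = C' at *
  have hC' : C * Cᴴ = 1 := mul_eq_one_comm.1 hC
  have e : g - g' = g' * (C' - C) * Cᴴ := by
    rw [mul_sub, h4, ← sub_mul, Matrix.mul_assoc, hC', Matrix.mul_one]
  have e1 : ‖C' - C‖ ≤ 4 * t / (1 + t ^ 2) := by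
    calc ‖C' - C‖ = ‖(C' - ((1 - t ^ 2) / (1 + t ^ 2) : ℝ) • 1) -
          (C - ((1 - t ^ 2) / (1 + t ^ 2) : ℝ) • 1)‖ := by rw [sub_sub_sub_cancel_right]
      _ ≤ 2 * t / (1 + t ^ 2) + 2 * t / (1 + t ^ 2) := (norm_sub_le _ _).trans (add_le_add hn' hn)
      _ = _ := by ring
  have e2 : ‖Cᴴ‖ ≤ 1 := norm_le_one_of_conjTranspose_mul_self (by rwa [conjTranspose_conjTranspose])
  have e3 := norm_le_one_of_conjTranspose_mul_self hg'
  rw [e]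
  calc ‖g' * (C' - C) * Cᴴ‖ ≤ ‖g'‖ * ‖C' - C‖ * ‖Cᴴ‖ :=
        (norm_mul_le _ _).trans (mul_le_mul_of_nonneg_right (norm_mul_le _ _) (norm_nonneg _))
    _ ≤ 1 * ‖C' - C‖ * 1 := by gcongr
    _ ≤ _ := by rwa [one_mul, mul_one]

theorem pairDet_I_le {d : ℕ} (H : Herm d) {t : ℝ} (hH : ‖H.1‖ ≤ t) :
    pairDet Complex.I H.1 ≤ (1 + t ^ 2) ^ d := by
  have hS := posDef_one_add_mul_self H.isHermitian
  have h1 : ‖(1 : Matrix (Fin d) (Fin d) ℂ)‖ ≤ 1 := norm_le_one_of_conjTranspose_mul_self (by simp)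
  have hn : ‖1 + H.1 * H.1‖ ≤ 1 + t ^ 2 := by
    calc ‖1 + H.1 * H.1‖ ≤ 1 + ‖H.1‖ * ‖H.1‖ :=
          (norm_add_le _ _).trans (add_le_add h1 (norm_mul_le _ _))
      _ ≤ 1 + t ^ 2 := by nlinarith [norm_nonneg H.1]
  rw [pairDet_eq, Complex.I_sq, neg_smul, one_smul, sub_neg_eq_add,
    hS.1.det_eq_prod_eigenvalues, norm_prod]
  calc ∏ i, ‖((hS.1.eigenvalues i : ℝ) : ℂ)‖ ≤ ∏ _i : Fin d, (1 + t ^ 2) := by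
        refine Finset.prod_le_prod (fun i _ => norm_nonneg _) fun i _ => ?_
        rw [Complex.norm_real]
        refine (spectrum.norm_le_norm_mul_of_mem (hS.1.eigenvalues_mem_spectrum_real i)).trans ?_
        calc _ ≤ (1 + t ^ 2) * 1 := by gcongr
          _ = _ := mul_one _
    _ = _ := by simp

theorem le_lintegral_cayleyWeight {d : ℕ} (μ : Measure (Herm d)) [μ.IsAddHaarMeasure] {t : ℝ}
    (ht : 0 ≤ t) :
    ENNReal.ofReal ((t / (1 + t ^ 2)) ^ d ^ 2) * μ (Metric.closedBall 0 1) ≤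
      ∫⁻ H in Metric.closedBall 0 t, cayleyWeight H ∂μ := by
  have h : ∀ H ∈ Metric.closedBall (0 : Herm d) t,
      ENNReal.ofReal (((1 + t ^ 2) ^ d)⁻¹ ^ d) ≤ cayleyWeight H := by
    intro H hH
    have hn : ‖H.1‖ ≤ t := by simpa using hH
    have hpos : 0 < pairDet Complex.I H.1 := by
      rw [pairDet_eq, Complex.I_sq, neg_smul, one_smul, sub_neg_eq_add, norm_pos_iff]
      exact ((isUnit_iff_isUnit_det _).1 (posDef_one_add_mul_self H.isHermitian).isUnit).ne_zero
    refine ENNReal.ofReal_le_ofReal (pow_le_pow_left₀ (by positivity) ?_ _)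
    exact inv_anti₀ hpos (pairDet_I_le H hn)
  refine le_trans (le_of_eq ?_) (setLIntegral_mono' measurableSet_closedBall h)
  rw [setLIntegral_const, Measure.addHaar_closedBall' μ _ ht, finrank_herm, ← mul_assoc,
    ← ENNReal.ofReal_mul (by positivity)]
  congr 2
  rw [div_pow, inv_pow, ← pow_mul, sq d]
  field_simp

theorem card_le_of_separated_of_isUnit {d : ℕ} (hd : 2 ≤ d) {ι : Type*} [Fintype ι]
    {g : ι → Matrix (Fin d) (Fin d) ℂ} (hg : ∀ i, (g i)ᴴ * g i = 1)
    (hg1 : ∀ i, IsUnit (1 - g i).det) {t : ℝ} (ht0 : 0 < t) (ht : t ≤ 1)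
    (hsep : ∀ i j, i ≠ j → 4 * t / (1 + t ^ 2) < ‖g i - g j‖) :
    (Fintype.card ι : ℝ) ≤ (3 / 2 * ((1 + t ^ 2) / t)) ^ d ^ 2 := by
  let μ : Measure (Herm d) := Measure.addHaar
  let s : ι → Set (Herm d) := fun i =>
    Metric.closedBall 0 t ∩ {H | IsUnit (moebiusDen (g i) H.1).det}
  have hopen : ∀ i, MeasurableSet {H : Herm d | IsUnit (moebiusDen (g i) H.1).det} := by
    intro i
    simp only [isUnit_iff_ne_zero]
    refine IsOpen.measurableSet (isOpen_ne_fun ?_ continuous_const)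
    unfold moebiusDen
    fun_prop
  have hs : ∀ i, MeasurableSet (s i) := fun i => measurableSet_closedBall.inter (hopen i)
  have himg : ∀ i, MeasurableSet (moebius (g i) '' s i) := fun i =>
    measurable_image_of_fderivWithin (hs i)
      (fun H hH => (hasFDerivAt_moebius (hg i) hH.2).hasFDerivWithinAt)
      ((injOn_moebius (hg i)).mono Set.inter_subset_right)
  have hdisj : Pairwise (Function.onFun Disjoint fun i => moebius (g i) '' s i) := by
    intro i j hij
    refine Set.disjoint_left.2 ?_
    rintro _ ⟨H, hH, rfl⟩ ⟨K, hK, hHK⟩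
    refine (hsep i j hij).not_ge ?_
    exact norm_sub_le_of_moebius_eq (hg i) (hg j) hH.2 hK.2 hHK.symm ht0.le ht
      (by simpa using hH.1) (by simpa using hK.1)
  have hlow : ∀ i, ENNReal.ofReal ((t / (1 + t ^ 2)) ^ d ^ 2) * μ (Metric.closedBall 0 1) ≤
      ∫⁻ H in moebius (g i) '' s i, cayleyWeight H ∂μ := by
    intro i
    rw [lintegral_image_moebius (hg i) μ (hs i) fun H hH => hH.2]
    refine (le_lintegral_cayleyWeight μ ht0.le).trans_eq (setLIntegral_congr ?_)
    filter_upwards [ae_isUnit_det_moebiusDen (hg1 i) μ] with H hH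
    exact propext ⟨fun h => ⟨h, hH⟩, fun h => h.1⟩
  have hup : ∫⁻ H, cayleyWeight H ∂μ ≤
      ENNReal.ofReal (ballConst d 0) * μ (Metric.closedBall 0 1) := by
    simpa [cayleyWeight] using lintegral_inv_pairDet_le d 0 μ
  have hsum : (Fintype.card ι : ℝ≥0∞) * (ENNReal.ofReal ((t / (1 + t ^ 2)) ^ d ^ 2) *
      μ (Metric.closedBall 0 1)) ≤ ENNReal.ofReal (ballConst d 0) * μ (Metric.closedBall 0 1) := by
    calc (Fintype.card ι : ℝ≥0∞) * (ENNReal.ofReal ((t / (1 + t ^ 2)) ^ d ^ 2) *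
          μ (Metric.closedBall 0 1))
        = ∑ _i : ι, ENNReal.ofReal ((t / (1 + t ^ 2)) ^ d ^ 2) * μ (Metric.closedBall 0 1) := by
          simp
      _ ≤ ∑ i, ∫⁻ H in moebius (g i) '' s i, cayleyWeight H ∂μ :=
          Finset.sum_le_sum fun i _ => hlow i
      _ = ∫⁻ H in ⋃ i, moebius (g i) '' s i, cayleyWeight H ∂μ := by
          rw [lintegral_iUnion himg hdisj, tsum_fintype]
      _ ≤ ∫⁻ H, cayleyWeight H ∂μ := setLIntegral_le_lintegral _ _
      _ ≤ _ := hup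
  have hV0 : μ (Metric.closedBall 0 1) ≠ 0 :=
    (Metric.measure_closedBall_pos μ 0 one_pos).ne'
  have hV1 : μ (Metric.closedBall 0 1) ≠ ∞ := measure_closedBall_lt_top.ne
  rw [← mul_assoc, ENNReal.mul_le_mul_iff_left hV0 hV1, ← ENNReal.ofReal_natCast,
    ← ENNReal.ofReal_mul (by positivity), ENNReal.ofReal_le_ofReal_iff (ballConst_pos _ _).le]
    at hsum
  have hb := hsum.trans (ballConst_zero_le hd)
  rw [mul_pow, ← inv_div t (1 + t ^ 2), inv_pow, ← div_eq_mul_inv, le_div_iff₀ (by positivity)]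
  exact hb

/-- Volumetric packing bound for the unitary group in operator norm. -/
theorem card_le_of_separated {d : ℕ} (hd : 2 ≤ d) {ι : Type*} [Fintype ι]
    {g : ι → Matrix (Fin d) (Fin d) ℂ} (hg : ∀ i, (g i)ᴴ * g i = 1) {r : ℝ} (hr0 : 0 < r)
    (hr2 : r ≤ 2) (hsep : ∀ i j, i ≠ j → r < ‖g i - g j‖) :
    (Fintype.card ι : ℝ) ≤ (6 / r) ^ d ^ 2 := by
  obtain ⟨t, ⟨ht0, ht1⟩, ht⟩ : ∃ t ∈ Set.Icc (0 : ℝ) 1, 4 * t / (1 + t ^ 2) = r := by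
    have hc : ContinuousOn (fun t : ℝ => 4 * t / (1 + t ^ 2)) (Set.Icc 0 1) := by
      refine ContinuousOn.div (by fun_prop) (by fun_prop) fun t _ => by positivity
    refine intermediate_value_Icc zero_le_one hc ⟨by simpa using hr0.le, ?_⟩
    norm_num
    exact hr2
  have htpos : 0 < t := by
    rcases ht0.eq_or_lt with h | h
    · rw [← h] at ht
      norm_num at ht
      exact absurd ht hr0.ne
    · exact h
  obtain ⟨z, hz, hu⟩ := exists_phase hg
  have hzz : star z * z = 1 := by
    rw [Complex.star_def, ← Complex.normSq_eq_conj_mul_self, Complex.normSq_eq_norm_sq, hz]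
    norm_num
  have h := card_le_of_separated_of_isUnit hd (g := fun i => z • g i)
    (fun i => by
      rw [conjTranspose_smul, smul_mul_smul_comm, hg, hzz, one_smul]) hu htpos ht1
    (fun i j hij => by
      rw [← smul_sub, norm_smul, hz, one_mul, ht]
      exact hsep i j hij)
  convert h using 2
  rw [← ht]
  field_simp
  norm_num

/-- A set whose `r`-separated finite subsets have bounded cardinality has a finite `r`-net obeying
the same bound. -/
theorem exists_net_of_forall_separated {X : Type*} [SeminormedAddCommGroup X] {S : Set X} {r B : ℝ}
    (h : ∀ N : Finset X, (∀ x ∈ N, x ∈ S) → (∀ x ∈ N, ∀ y ∈ N, x ≠ y → r < ‖x - y‖) →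
      (N.card : ℝ) ≤ B) :
    ∃ N : Finset X, (∀ x ∈ N, x ∈ S) ∧ (N.card : ℝ) ≤ B ∧
      ∀ x ∈ S, ∃ y ∈ N, ‖x - y‖ ≤ max r 0 := by
  classical
  let P : ℕ → Prop := fun n => ∃ N : Finset X, (∀ x ∈ N, x ∈ S) ∧
    (∀ x ∈ N, ∀ y ∈ N, x ≠ y → r < ‖x - y‖) ∧ N.card = n
  have hne : Set.Nonempty {n | P n} := ⟨0, ∅, by simp⟩
  have hbd : BddAbove {n | P n} := by
    refine ⟨⌊B⌋₊, ?_⟩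
    rintro n ⟨N, h1, h2, rfl⟩
    exact Nat.le_floor (h N h1 h2)
  obtain ⟨N, h1, h2, h3⟩ := Nat.sSup_mem hne hbd
  refine ⟨N, h1, h N h1 h2, fun x hx => ?_⟩
  by_contra! hcon
  have hfar : ∀ y ∈ N, r < ‖x - y‖ := fun y hy => (le_max_left _ _).trans_lt (hcon y hy)
  have hxN : x ∉ N := fun hxN => by
    have := hcon x hxN
    rw [sub_self, norm_zero] at this
    exact absurd this (le_max_right _ _).not_gt
  have hP : P (N.card + 1) := by
    refine ⟨insert x N, ?_, ?_, Finset.card_insert_of_notMem hxN⟩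
    · intro y hy
      rcases Finset.mem_insert.1 hy with rfl | hy
      exacts [hx, h1 y hy]
    · intro y hy z hz hyz
      rcases Finset.mem_insert.1 hy with hyx | hyN <;>
        rcases Finset.mem_insert.1 hz with hzx | hzN
      · exact absurd (hyx.trans hzx.symm) hyz
      · exact hyx ▸ hfar z hzN
      · rw [norm_sub_rev, hzx]
        exact hfar y hyN
      · exact h2 y hyN z hzN hyz
  have := le_csSup hbd hP
  omega

theorem exists_unitary_net_of_two_le {d : ℕ} (hd : 2 ≤ d) {r : ℝ} (hr0 : 0 < r) (hr2 : r ≤ 2) :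
    ∃ N : Finset (Matrix (Fin d) (Fin d) ℂ), (∀ g ∈ N, gᴴ * g = 1) ∧
      (N.card : ℝ) ≤ (6 / r) ^ d ^ 2 ∧
      ∀ U : Matrix (Fin d) (Fin d) ℂ, Uᴴ * U = 1 → ∃ g ∈ N, ‖U - g‖ ≤ r := by
  obtain ⟨N, h1, h2, h3⟩ := exists_net_of_forall_separated
    (S := {U : Matrix (Fin d) (Fin d) ℂ | Uᴴ * U = 1}) (r := r) (B := (6 / r) ^ d ^ 2)
    fun N hN hsep => by
      have := card_le_of_separated hd (ι := N) (g := fun x => x.1) (fun x => hN x x.2) hr0 hr2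
        fun x y hxy => hsep x x.2 y y.2 fun h => hxy (Subtype.ext h)
      simpa using this
  rw [max_eq_left hr0.le] at h3
  exact ⟨N, h1, h2, h3⟩

theorem exists_circle_net {r : ℝ} (hr0 : 0 < r) (hr2 : r ≤ 2) :
    ∃ N : Finset ℂ, (∀ z ∈ N, ‖z‖ = 1) ∧ (N.card : ℝ) ≤ 6 / r ∧
      ∀ w : ℂ, ‖w‖ = 1 → ∃ z ∈ N, ‖w - z‖ ≤ r := by
  classical
  have hπ := Real.pi_pos
  let m := ⌈Real.pi / r⌉₊
  have hm : 0 < m := Nat.ceil_pos.2 (by positivity)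
  have hm' : (0 : ℝ) < m := by exact_mod_cast hm
  let θ : ℕ → ℝ := fun k => -Real.pi + (2 * k + 1) * (Real.pi / m)
  refine ⟨(Finset.range m).image fun k => Complex.exp (θ k * Complex.I), ?_, ?_, ?_⟩
  · intro z hz
    obtain ⟨k, -, rfl⟩ := Finset.mem_image.1 hz
    exact Complex.norm_exp_ofReal_mul_I _
  · calc _ ≤ (m : ℝ) := by
          exact_mod_cast Finset.card_image_le.trans_eq (Finset.card_range m)
      _ ≤ Real.pi / r + 1 := (Nat.ceil_lt_add_one (by positivity)).le
      _ ≤ 6 / r := by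
          rw [div_add_one hr0.ne']
          gcongr
          linarith [Real.pi_lt_four]
  · intro w hw
    let x := (w.arg + Real.pi) * m / (2 * Real.pi)
    have hx0 : 0 < x := by
      have := Complex.neg_pi_lt_arg w
      have : 0 < w.arg + Real.pi := by linarith
      positivity
    have hxm : x ≤ m := by
      rw [div_le_iff₀ (by positivity)]
      have := Complex.arg_le_pi w
      nlinarith
    have harg : w.arg = -Real.pi + 2 * x * (Real.pi / m) := by
      simp only [x]
      field_simp
      ring
    have hc := Nat.ceil_pos.2 hx0
    refine ⟨_, Finset.mem_image_of_mem _ (Finset.mem_range.2 (?_ : ⌈x⌉₊ - 1 < m)), ?_⟩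
    · have := Nat.ceil_le.2 hxm
      omega
    · have hw' : w = Complex.exp (w.arg * Complex.I) := by
        conv_lhs => rw [← Complex.norm_mul_exp_arg_mul_I w, hw]
        simp
      have hk : ((⌈x⌉₊ - 1 : ℕ) : ℝ) = ⌈x⌉₊ - 1 := by
        rw [Nat.cast_sub hc, Nat.cast_one]
      set k := ⌈x⌉₊ - 1
      have h1 := Nat.le_ceil x
      have h2 := Nat.ceil_lt_add_one hx0.le
      have hle : ‖w - Complex.exp (θ k * Complex.I)‖ ≤ |w.arg - θ k| := by
        have : w - Complex.exp (θ k * Complex.I) = Complex.exp (θ k * Complex.I) *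
            (Complex.exp (Complex.I * ((w.arg - θ k : ℝ) : ℂ)) - 1) := by
          rw [mul_sub, ← Complex.exp_add, mul_one]
          conv_lhs => rw [hw']
          congr 2
          push_cast
          ring
        rw [this, norm_mul, Complex.norm_exp_ofReal_mul_I, one_mul]
        exact Real.norm_exp_I_mul_ofReal_sub_one_le
      refine hle.trans ?_
      have : w.arg - θ k = (2 * (x - ⌈x⌉₊) + 1) * (Real.pi / m) := by
        rw [harg]
        simp only [θ, hk]
        ring
      rw [this, abs_mul, abs_of_pos (a := Real.pi / m) (by positivity)]
      have hb : |2 * (x - ⌈x⌉₊) + 1| ≤ 1 := by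
        rw [abs_le]
        constructor <;> linarith
      have hpm : Real.pi / m ≤ r := by
        rw [div_le_iff₀ hm', mul_comm, ← div_le_iff₀ hr0]
        exact Nat.le_ceil _
      nlinarith [abs_nonneg (2 * (x - ⌈x⌉₊) + 1), div_pos hπ hm']

theorem exists_unitary_net {d : ℕ} (hd : 1 ≤ d) {r : ℝ} (hr0 : 0 < r) (hr2 : r ≤ 2) :
    ∃ N : Finset (Matrix (Fin d) (Fin d) ℂ), (∀ g ∈ N, gᴴ * g = 1) ∧
      (N.card : ℝ) ≤ (6 / r) ^ d ^ 2 ∧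
      ∀ U : Matrix (Fin d) (Fin d) ℂ, Uᴴ * U = 1 → ∃ g ∈ N, ‖U - g‖ ≤ r := by
  classical
  rcases hd.eq_or_lt with rfl | hd
  · obtain ⟨N, h1, h2, h3⟩ := exists_circle_net hr0 hr2
    have hU : ∀ U : Matrix (Fin 1) (Fin 1) ℂ, U = U 0 0 • 1 := fun U => by
      ext i j
      fin_cases i
      fin_cases j
      simp
    refine ⟨N.image fun z => z • 1, ?_, ?_, fun U h => ?_⟩
    · intro g hg
      obtain ⟨z, hz, rfl⟩ := Finset.mem_image.1 hg
      have hzz : star z * z = 1 := by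
        rw [Complex.star_def, ← Complex.normSq_eq_conj_mul_self, Complex.normSq_eq_norm_sq, h1 z hz]
        norm_num
      rw [conjTranspose_smul, smul_mul_smul_comm, conjTranspose_one, hzz, one_mul, one_smul]
    · rw [one_pow, pow_one]
      refine le_trans ?_ h2
      exact_mod_cast Finset.card_image_le
    · have hn : ‖U 0 0‖ = 1 := by
        have := congrFun (congrFun h 0) 0
        rw [mul_apply, Fin.sum_univ_one, conjTranspose_apply, one_apply_eq, Complex.star_def,
          ← Complex.normSq_eq_conj_mul_self, Complex.normSq_eq_norm_sq] at this
        have : ‖U 0 0‖ ^ 2 = 1 := by exact_mod_cast this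
        exact (pow_eq_one_iff_of_nonneg (norm_nonneg _) two_ne_zero).1 this
      obtain ⟨z, hz, hzr⟩ := h3 _ hn
      refine ⟨_, Finset.mem_image_of_mem _ hz, ?_⟩
      rw [hU U, ← sub_smul, norm_smul]
      simpa using hzr
  · exact exists_unitary_net_of_two_le hd hr0 hr2

/-- Matrix of the real-linear map given by `U` in the coordinates `(x, y) ↦ x - i y`. -/
def realify {M : ℕ} (U : Matrix (Fin M) (Fin M) ℂ) : Matrix (Fin (2 * M)) (Fin (2 * M)) ℝ :=
  Matrix.reindex (finSumFinEquiv.trans (finCongr (two_mul M).symm))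
    (finSumFinEquiv.trans (finCongr (two_mul M).symm))
    (fromBlocks (U.map Complex.re) (U.map Complex.im) (-U.map Complex.im) (U.map Complex.re))

theorem realify_sub {M : ℕ} (U V : Matrix (Fin M) (Fin M) ℂ) :
    realify (U - V) = realify U - realify V := by
  ext i j
  obtain ⟨i, rfl⟩ := (finSumFinEquiv.trans (finCongr (two_mul M).symm)).surjective i
  obtain ⟨j, rfl⟩ := (finSumFinEquiv.trans (finCongr (two_mul M).symm)).surjective j
  simp only [realify, reindex_apply, submatrix_apply, Equiv.symm_apply_apply, Matrix.sub_apply]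
  rcases i with i | i <;> rcases j with j | j <;> simp [neg_add_eq_sub]

theorem conjTranspose_mul_self_re_im {M : ℕ} (U : Matrix (Fin M) (Fin M) ℂ) :
    Uᴴ * U = 1 ↔
      (U.map Complex.re)ᵀ * U.map Complex.re + (U.map Complex.im)ᵀ * U.map Complex.im = 1 ∧
      (U.map Complex.re)ᵀ * U.map Complex.im - (U.map Complex.im)ᵀ * U.map Complex.re = 0 := by
  simp only [← Matrix.ext_iff, ← forall_and]
  refine forall_congr' fun i => forall_congr' fun j => ?_
  rw [Complex.ext_iff]
  simp only [mul_apply, conjTranspose_apply, Matrix.add_apply, Matrix.sub_apply, transpose_apply,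
    map_apply, Complex.re_sum, Complex.im_sum, ← Finset.sum_add_distrib, ← Finset.sum_sub_distrib,
    Matrix.zero_apply]
  have h1 : ((1 : Matrix (Fin M) (Fin M) ℂ) i j).re = (1 : Matrix (Fin M) (Fin M) ℝ) i j := by
    by_cases h : i = j <;> simp [one_apply, h]
  have h2 : ((1 : Matrix (Fin M) (Fin M) ℂ) i j).im = 0 := by
    by_cases h : i = j <;> simp [one_apply, h]
  rw [h1, h2]
  simp [sub_eq_add_neg]

theorem realify_mem_KK {M : ℕ} {U : Matrix (Fin M) (Fin M) ℂ} (hU : Uᴴ * U = 1) :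
    realify U ∈ KK M := by
  obtain ⟨h1, h2⟩ := (conjTranspose_mul_self_re_im U).1 hU
  have h3 := sub_eq_zero.1 h2
  constructor
  · unfold realify
    simp only [reindex_apply, transpose_submatrix, submatrix_mul_equiv, fromBlocks_transpose,
      fromBlocks_multiply, transpose_neg, Matrix.neg_mul, Matrix.mul_neg, neg_neg, h1, h3,
      add_comm ((U.map Complex.im)ᵀ * U.map Complex.im), ← sub_eq_add_neg, sub_self,
      fromBlocks_one, submatrix_one_equiv]
  · unfold realify Omg
    simp only [reindex_apply, transpose_submatrix, submatrix_mul_equiv, fromBlocks_transpose,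
      fromBlocks_multiply, transpose_neg, Matrix.neg_mul, Matrix.mul_neg, neg_neg, mul_zero,
      mul_one, zero_add, add_zero, h1, h3, neg_add_cancel, add_neg_cancel,
      ← neg_add, add_comm ((U.map Complex.im)ᵀ * U.map Complex.im)]

theorem exists_realify_eq {M : ℕ} {A : Matrix (Fin (2 * M)) (Fin (2 * M)) ℝ} (hA : A ∈ KK M) :
    ∃ U : Matrix (Fin M) (Fin M) ℂ, Uᴴ * U = 1 ∧ realify U = A := by
  obtain ⟨h1, h2⟩ := hA
  have hcomm : Omg M * A = A * Omg M := by
    have h3 := mul_eq_one_comm.1 h1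
    calc Omg M * A = A * (Aᵀ * Omg M * A) := by rw [mul_assoc, ← mul_assoc, h3, one_mul]
      _ = _ := by rw [h2]
  let e : Fin M ⊕ Fin M ≃ Fin (2 * M) := finSumFinEquiv.trans (finCongr (two_mul M).symm)
  obtain ⟨Z, rfl⟩ := (reindex e e).surjective A
  have hZ := (fromBlocks_toBlocks Z).symm
  set a := Z.toBlocks₁₁
  set b := Z.toBlocks₁₂
  set c := Z.toBlocks₂₁
  set d := Z.toBlocks₂₂
  rw [hZ] at h1 hcomm ⊢
  have hO : Omg M = reindex e e (fromBlocks 0 1 (-1) 0) := rfl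
  rw [hO] at hcomm
  simp only [reindex_apply, submatrix_mul_equiv, fromBlocks_multiply, zero_mul, mul_zero, one_mul,
    mul_one, Matrix.neg_mul, Matrix.mul_neg, zero_add, add_zero] at hcomm
  have hcomm' := (reindex e e).injective hcomm
  obtain ⟨hc, hd, -, -⟩ := fromBlocks_inj.1 hcomm'
  rw [hc, hd] at h1 ⊢
  let U : Matrix (Fin M) (Fin M) ℂ := of fun i j => ⟨a i j, b i j⟩
  have hre : U.map Complex.re = a := rfl
  have him : U.map Complex.im = b := rfl
  refine ⟨U, ?_, rfl⟩
  rw [conjTranspose_mul_self_re_im, hre, him]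
  simp only [reindex_apply, transpose_submatrix, submatrix_mul_equiv, fromBlocks_transpose,
    fromBlocks_multiply, transpose_neg, Matrix.neg_mul, Matrix.mul_neg, neg_neg] at h1
  rw [← submatrix_one_equiv e.symm, ← fromBlocks_one] at h1
  obtain ⟨h5, h6, -, -⟩ := fromBlocks_inj.1 ((reindex e e).injective h1)
  exact ⟨h5, by rw [sub_eq_add_neg]; exact h6⟩

/-- Euclidean vectors of even dimension as complex vectors, in the coordinates of `realify`. -/
def complexify {M : ℕ} (v : Fin (2 * M) → ℝ) : Fin M → ℂ := fun i =>
  ⟨v (finSumFinEquiv.trans (finCongr (two_mul M).symm) (.inl i)),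
    -v (finSumFinEquiv.trans (finCongr (two_mul M).symm) (.inr i))⟩

theorem norm_complexify {M : ℕ} (v : Fin (2 * M) → ℝ) :
    ‖WithLp.toLp 2 (complexify v)‖ = ‖WithLp.toLp 2 v‖ := by
  rw [EuclideanSpace.norm_eq, EuclideanSpace.norm_eq,
    ← (finSumFinEquiv.trans (finCongr (two_mul M).symm)).sum_comp, Fintype.sum_sum_type,
    ← Finset.sum_add_distrib]
  congr 1
  refine Finset.sum_congr rfl fun i _ => ?_
  rw [← Complex.normSq_eq_norm_sq, Complex.normSq_apply]
  simp [complexify, sq]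

theorem complexify_realify_mulVec {M : ℕ} (U : Matrix (Fin M) (Fin M) ℂ) (v : Fin (2 * M) → ℝ) :
    complexify (realify U *ᵥ v) = U *ᵥ complexify v := by
  ext i
  simp only [complexify, mulVec, dotProduct, realify,
    ← (finSumFinEquiv.trans (finCongr (two_mul M).symm)).sum_comp (fun j => _ * v j),
    Fintype.sum_sum_type, reindex_apply, submatrix_apply, Equiv.symm_apply_apply,
    fromBlocks_apply₁₁, fromBlocks_apply₁₂, fromBlocks_apply₂₁, fromBlocks_apply₂₂, map_apply,
    Matrix.neg_apply]
  apply Complex.ext <;>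
    simp [Complex.re_sum, Complex.im_sum, ← Finset.sum_add_distrib, ← Finset.sum_neg_distrib,
      add_comm]

theorem opN_realify_le {M : ℕ} (U : Matrix (Fin M) (Fin M) ℂ) : opN (realify U) ≤ ‖U‖ := by
  refine ContinuousLinearMap.opNorm_le_bound _ (norm_nonneg _) fun v => ?_
  have h := l2_opNorm_mulVec U (WithLp.toLp 2 (complexify v.ofLp))
  rw [norm_complexify] at h
  refine le_trans (le_of_eq ?_) h
  change ‖WithLp.toLp 2 (realify U *ᵥ v.ofLp)‖ = _
  rw [← norm_complexify, complexify_realify_mulVec]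
  rfl

/-- Covering number bound for `K(2M)`: for `0 < r ≤ 2` there is an `r`-net
`N ⊆ K(2M)` of cardinality at most `(6/r)^{M²}` in operator norm. -/
theorem covering_number_K (M : ℕ) (hM : 1 ≤ M) (r : ℝ) (hr0 : 0 < r) (hr2 : r ≤ 2) :
    ∃ N : Finset (Matrix (Fin (2*M)) (Fin (2*M)) ℝ),
      (↑N : Set (Matrix (Fin (2*M)) (Fin (2*M)) ℝ)) ⊆ KK M ∧
      (N.card : ℝ) ≤ (6/r)^(M^2) ∧
      ∀ O ∈ KK M, ∃ g ∈ N, opN (O - g) ≤ r := by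
  classical
  obtain ⟨N, h1, h2, h3⟩ := exists_unitary_net hM hr0 hr2
  refine ⟨N.image realify, ?_, ?_, ?_⟩
  · intro g hg
    obtain ⟨U, hU, rfl⟩ := Finset.mem_image.1 (Finset.mem_coe.1 hg)
    exact realify_mem_KK (h1 U hU)
  · refine le_trans ?_ h2
    exact_mod_cast Finset.card_image_le
  · intro O hO
    obtain ⟨U, hU, rfl⟩ := exists_realify_eq hO
    obtain ⟨g, hg, hUg⟩ := h3 U hU
    refine ⟨_, Finset.mem_image_of_mem _ hg, ?_⟩
    rw [← realify_sub]
    exact (opN_realify_le _).trans hUg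
end
end

section
/- Let M ≥ 1, E > 0, and let A, B ∈ K(2M) with κ₁,…,κ_{2M} the singular values of A − B. Let σ be the uniform (rotation-invariant) probability measure on the unit sphere S^{2M−1} ⊂ ℝ^{2M}. Then 1 − C₁(B) = ∫ exp(−½‖(A−B)x‖²) dσ_E(x) = Γ(M)·π^{−M} · Σ_{i ∈ ℕ^{2M}} [ ∏_{j=1}^{2M} ((−E κ_j²)^{i_j}/i_j!)·Γ(i_j + ½) ] / Γ(M + i_1 + ⋯ + i_{2M}), where σ_E is the uniform probability measure on the sphere of radius √(2E) in ℝ^{2M} and the series converges absolutely. -/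
open MeasureTheory Matrix

noncomputable section

section Rotation

variable {F : Type*} [NormedAddCommGroup F] [InnerProductSpace ℝ F] [FiniteDimensional ℝ F]
  [MeasurableSpace F] [BorelSpace F]

lemma charFun_eq_of_norm_eq {μ : Measure F} (hμ : ∀ e : F ≃ₗᵢ[ℝ] F, Measure.map e μ = μ)
    {s t : F} (h : ‖s‖ = ‖t‖) : charFun μ s = charFun μ t := by
  obtain ⟨e, rfl⟩ : ∃ e : F ≃ₗᵢ[ℝ] F, e s = t := ⟨_, Submodule.reflection_sub h⟩
  conv_rhs => rw [← hμ e]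
  rw [charFun_apply, charFun_apply, integral_map (by fun_prop) (by fun_prop)]
  simp

/-- A rotation-invariant measure is the law of `‖z‖ • x` with `z` distributed according to the
measure and `x` independent and uniform on the unit sphere. -/
lemma map_norm_smul_prod_eq {ν σ : Measure F} [IsFiniteMeasure ν] [IsProbabilityMeasure σ]
    (hν : ∀ e : F ≃ₗᵢ[ℝ] F, Measure.map e ν = ν) (hσ : ∀ e : F ≃ₗᵢ[ℝ] F, Measure.map e σ = σ)
    (hσ_norm : ∀ᵐ x ∂σ, ‖x‖ = 1) :
    Measure.map (fun p : F × F => ‖p.1‖ • p.2) (ν.prod σ) = ν := by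
  have hint : ∀ f : F × F → ℝ, Continuous f →
      Integrable (fun p => Complex.exp (f p * Complex.I)) (ν.prod σ) := fun f hf =>
    Integrable.of_bound (C := 1) (by fun_prop) (by simp [Complex.norm_exp_ofReal_mul_I])
  refine Measure.ext_of_charFun (funext fun t => ?_)
  calc charFun (Measure.map (fun p : F × F => ‖p.1‖ • p.2) (ν.prod σ)) t
      = ∫ p, Complex.exp ((inner ℝ (‖p.1‖ • p.2) t : ℝ) * Complex.I) ∂(ν.prod σ) := by
        rw [charFun_apply, integral_map (by fun_prop) (by fun_prop)]
    _ = ∫ z, charFun σ (‖z‖ • t) ∂ν := by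
        rw [integral_prod _ (hint _ (by fun_prop))]
        simp [charFun_apply, inner_smul_left, inner_smul_right]
    _ = ∫ z, charFun σ (‖t‖ • z) ∂ν := by
        refine integral_congr_ae (.of_forall fun z => charFun_eq_of_norm_eq hσ ?_)
        simp [norm_smul, mul_comm]
    _ = ∫ x, charFun ν (‖t‖ • x) ∂σ := by
        simp only [charFun_apply]
        rw [integral_integral_swap (f := fun z x : F =>
          Complex.exp ((inner ℝ x (‖t‖ • z) : ℝ) * Complex.I))
          (hint (fun p : F × F => inner ℝ p.2 (‖t‖ • p.1)) (by fun_prop))]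
        simp [inner_smul_right, real_inner_comm]
    _ = ∫ x, charFun ν t ∂σ := by
        refine integral_congr_ae (hσ_norm.mono fun x hx => charFun_eq_of_norm_eq hν ?_)
        simp [norm_smul, hx]
    _ = charFun ν t := by simp

lemma map_withDensity_norm_eq (g : ℝ → ENNReal) (hg : Measurable g) (e : F ≃ₗᵢ[ℝ] F) :
    Measure.map e ((volume : Measure F).withDensity fun x => g ‖x‖)
      = (volume : Measure F).withDensity fun x => g ‖x‖ := by
  ext s hs
  rw [Measure.map_apply (by fun_prop) hs, withDensity_apply _ hs,
    withDensity_apply _ (e.continuous.measurable hs),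
    ← e.measurePreserving.setLIntegral_comp_preimage hs (by fun_prop)]
  simp

end Rotation

section GaussianMoments

lemma integral_pow_mul_exp_neg_sq_Ioi (m : ℕ) :
    ∫ x in Set.Ioi (0 : ℝ), x ^ m * Real.exp (-x ^ 2) = Real.Gamma (((m : ℝ) + 1) / 2) / 2 := by
  have h := integral_rpow_mul_exp_neg_rpow (p := 2) (q := m) (by norm_num)
    (by have : (0 : ℝ) ≤ m := m.cast_nonneg
        linarith)
  simp only [Real.rpow_natCast, Real.rpow_two] at h
  rw [h]
  ring

lemma integral_even_pow_mul_exp_neg_sq (k : ℕ) :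
    ∫ x : ℝ, x ^ (2 * k) * Real.exp (-x ^ 2) = Real.Gamma ((k : ℝ) + 1 / 2) := by
  have h := integral_comp_abs (f := fun x : ℝ => x ^ (2 * k) * Real.exp (-x ^ 2))
  simp only [pow_mul, sq_abs] at h
  simp only [← pow_mul] at h
  rw [h, integral_pow_mul_exp_neg_sq_Ioi]
  push_cast
  rw [mul_div_cancel₀ _ (two_ne_zero)]
  congr 1
  ring

variable {n : ℕ}

lemma integral_prod_even_pow_mul_exp_neg_norm_sq (i : Fin n → ℕ) :
    ∫ z : EuclideanSpace ℝ (Fin n), Real.exp (-‖z‖ ^ 2) * ∏ j, z j ^ (2 * i j)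
      = ∏ j, Real.Gamma ((i j : ℝ) + 1 / 2) := by
  simp_rw [← integral_even_pow_mul_exp_neg_sq]
  rw [← integral_fintype_prod_volume_eq_prod
      (f := fun j (x : ℝ) => x ^ (2 * i j) * Real.exp (-x ^ 2)),
    ← (EuclideanSpace.volume_preserving_symm_measurableEquiv_toLp (Fin n)).integral_comp']
  refine integral_congr_ae (.of_forall fun z => ?_)
  simp only [Finset.prod_mul_distrib, ← Real.exp_sum, EuclideanSpace.norm_sq_eq,
    Finset.sum_neg_distrib, Real.norm_eq_abs, sq_abs]
  exact mul_comm _ _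

lemma integrable_exp_neg_norm_sq :
    Integrable fun z : EuclideanSpace ℝ (Fin n) => Real.exp (-‖z‖ ^ 2) := by
  by_contra h
  have h1 := integral_prod_even_pow_mul_exp_neg_norm_sq (n := n) 0
  simp only [Pi.zero_apply, mul_zero, pow_zero, Finset.prod_const_one, mul_one,
    integral_undef h] at h1
  exact (Finset.prod_pos fun j _ => Real.Gamma_pos_of_pos (by positivity)).ne h1

lemma integral_norm_pow_mul_exp_neg_norm_sq {M : ℕ} (hM : 1 ≤ M) (k : ℕ) :
    ∫ z : EuclideanSpace ℝ (Fin (2 * M)), Real.exp (-‖z‖ ^ 2) * ‖z‖ ^ (2 * k)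
      = Real.pi ^ M / Real.Gamma M * Real.Gamma ((M : ℝ) + k) := by
  have : Nonempty (Fin (2 * M)) := ⟨⟨0, by omega⟩⟩
  have hM0 : (0 : ℝ) < M := by exact_mod_cast hM
  have hball : (volume : Measure (EuclideanSpace ℝ (Fin (2 * M)))).real (Metric.ball 0 1)
      = Real.pi ^ M / (M * Real.Gamma M) := by
    rw [Measure.real, EuclideanSpace.volume_ball, ← Real.Gamma_add_one hM0.ne']
    simp only [ENNReal.ofReal_one, one_pow, one_mul, Fintype.card_fin, pow_mul,
      Real.sq_sqrt Real.pi_pos.le]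
    have e : ((2 * M : ℕ) : ℝ) / 2 + 1 = M + 1 := by push_cast; ring
    rw [e, ENNReal.toReal_ofReal]
    exact div_nonneg (by positivity) (Real.Gamma_pos_of_pos (by positivity)).le
  rw [integral_fun_norm_addHaar volume
    (fun r : ℝ => Real.exp (-r ^ 2) * r ^ (2 * k)), hball, finrank_euclideanSpace_fin]
  have h : ∀ y : ℝ, y ^ (2 * M - 1) • (Real.exp (-y ^ 2) * y ^ (2 * k))
      = y ^ (2 * M - 1 + 2 * k) * Real.exp (-y ^ 2) := fun y => by
    rw [smul_eq_mul, pow_add]; ring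
  simp_rw [h]
  rw [integral_pow_mul_exp_neg_sq_Ioi]
  have hc : (((2 * M - 1 + 2 * k : ℕ) : ℝ) + 1) / 2 = M + k := by
    have : 2 * M - 1 + 2 * k + 1 = 2 * (M + k) := by omega
    have h2 : (((2 * M - 1 + 2 * k : ℕ) : ℝ) + 1) = 2 * (M + k) := by exact_mod_cast this
    rw [h2]; ring
  rw [hc, nsmul_eq_mul, smul_eq_mul]
  have := Real.Gamma_pos_of_pos hM0
  push_cast
  field_simp

/-- Even moments of the uniform probability measure on the unit sphere of `ℝ^{2M}`. -/
lemma integral_prod_even_pow_sphere {M : ℕ} (hM : 1 ≤ M)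
    {σ : Measure (EuclideanSpace ℝ (Fin (2 * M)))} [IsProbabilityMeasure σ]
    (hσ_norm : ∀ᵐ x ∂σ, ‖x‖ = 1)
    (hσ : ∀ e : EuclideanSpace ℝ (Fin (2 * M)) ≃ₗᵢ[ℝ] EuclideanSpace ℝ (Fin (2 * M)),
      Measure.map e σ = σ) (i : Fin (2 * M) → ℕ) :
    ∫ x, ∏ j, x j ^ (2 * i j) ∂σ
      = Real.Gamma M * (Real.pi ^ M)⁻¹ *
        ((∏ j, Real.Gamma ((i j : ℝ) + 1 / 2)) / Real.Gamma ((M : ℝ) + ∑ j, (i j : ℝ))) := by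
  have hM0 : (0 : ℝ) < M := by exact_mod_cast hM
  set ν : Measure (EuclideanSpace ℝ (Fin (2 * M))) :=
    volume.withDensity fun z => ENNReal.ofReal (Real.exp (-‖z‖ ^ 2)) with hν
  have hν_rot : ∀ e : EuclideanSpace ℝ (Fin (2 * M)) ≃ₗᵢ[ℝ] EuclideanSpace ℝ (Fin (2 * M)),
      Measure.map e ν = ν :=
    map_withDensity_norm_eq (fun r => ENNReal.ofReal (Real.exp (-r ^ 2))) (by fun_prop)
  have : IsFiniteMeasure ν := isFiniteMeasure_withDensity_ofReal integrable_exp_neg_norm_sq.2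
  have hint (f : EuclideanSpace ℝ (Fin (2 * M)) → ℝ) :
      ∫ z, f z ∂ν = ∫ z, Real.exp (-‖z‖ ^ 2) * f z := by
    rw [hν, integral_withDensity_eq_integral_toReal_smul (by fun_prop) (by simp)]
    simp [ENNReal.toReal_ofReal (Real.exp_pos _).le]
  have key : ∏ j, Real.Gamma ((i j : ℝ) + 1 / 2)
      = (Real.pi ^ M / Real.Gamma M * Real.Gamma ((M : ℝ) + ∑ j, (i j : ℝ)))
        * ∫ x, ∏ j, x j ^ (2 * i j) ∂σ := by
    have h := integral_norm_pow_mul_exp_neg_norm_sq hM (∑ j, i j)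
    push_cast at h
    rw [← integral_prod_even_pow_mul_exp_neg_norm_sq, ← h, ← hint, ← hint, ← integral_prod_mul]
    conv_lhs => rw [← map_norm_smul_prod_eq hν_rot hσ hσ_norm]
    rw [integral_map (by fun_prop) (by fun_prop)]
    simp [mul_pow, Finset.prod_mul_distrib, Finset.prod_pow_eq_pow_sum, Finset.mul_sum]
  have h1 := Real.Gamma_pos_of_pos hM0
  have h2 : 0 < Real.Gamma ((M : ℝ) + ∑ j, (i j : ℝ)) := Real.Gamma_pos_of_pos (by positivity)
  rw [key]
  field_simp

end GaussianMoments

lemma summable_norm_and_hasSum_prod_pi {n : ℕ} {f : Fin n → ℕ → ℝ}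
    (hf : ∀ j, Summable fun k => ‖f j k‖) :
    (Summable fun i : Fin n → ℕ => ‖∏ j, f j (i j)‖) ∧
      HasSum (fun i : Fin n → ℕ => ∏ j, f j (i j)) (∏ j, ∑' k, f j k) := by
  induction n with
  | zero =>
    refine ⟨.of_finite, ?_⟩
    simp
  | succ n ih =>
    obtain ⟨h1, h2⟩ := ih (f := fun j => f j.succ) fun j => hf j.succ
    have hs := (hf 0).mul_norm h1
    constructor
    · rw [← (Fin.consEquiv fun _ => ℕ).summable_iff]
      refine hs.congr fun p => ?_
      simp [Fin.prod_univ_succ, Fin.consEquiv]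
    · rw [← (Fin.consEquiv fun _ => ℕ).hasSum_iff, Fin.prod_univ_succ]
      convert! (hf 0).of_norm.hasSum.mul h2 hs.of_norm using 1
      ext p
      simp [Fin.prod_univ_succ, Fin.consEquiv]

lemma norm_mv_of_orthogonal {n : ℕ} {V : Matrix (Fin n) (Fin n) ℝ} (hV : Vᵀ * V = 1)
    (x : EuclideanSpace ℝ (Fin n)) : ‖mv V x‖ = ‖x‖ := by
  rw [← sq_eq_sq₀ (norm_nonneg _) (norm_nonneg _), ← real_inner_self_eq_norm_sq,
    ← real_inner_self_eq_norm_sq]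
  simp only [mv, EuclideanSpace.inner_eq_star_dotProduct, Matrix.ofLp_toEuclideanCLM, star_trivial]
  rw [Matrix.dotProduct_mulVec, Matrix.vecMul_mulVec, hV, Matrix.vecMul_one]

lemma exists_linearIsometryEquiv_eq_mv {n : ℕ} {V : Matrix (Fin n) (Fin n) ℝ} (hV : Vᵀ * V = 1) :
    ∃ e : EuclideanSpace ℝ (Fin n) ≃ₗᵢ[ℝ] EuclideanSpace ℝ (Fin n), ∀ x, e x = mv V x :=
  ⟨LinearIsometry.toLinearIsometryEquiv
    ⟨(Matrix.toEuclideanCLM (𝕜 := ℝ) V).toLinearMap, norm_mv_of_orthogonal hV⟩ rfl, fun _ => rfl⟩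

lemma norm_sq_mv_diagonal {n : ℕ} (κ x : Fin n → ℝ) :
    ‖mv (Matrix.diagonal κ) (WithLp.toLp 2 x)‖ ^ 2 = ∑ j, κ j ^ 2 * x j ^ 2 := by
  simp [mv, EuclideanSpace.norm_sq_eq, Matrix.mulVec_diagonal, mul_pow]

/-- Laplace transform of a diagonal quadratic form under the uniform probability measure on the
unit sphere of `ℝ^{2M}`. -/
lemma integral_exp_quadratic_sphere_eq_tsum {M : ℕ} (hM : 1 ≤ M)
    {σ : Measure (EuclideanSpace ℝ (Fin (2 * M)))} [IsProbabilityMeasure σ]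
    (hσ_norm : ∀ᵐ x ∂σ, ‖x‖ = 1)
    (hσ : ∀ e : EuclideanSpace ℝ (Fin (2 * M)) ≃ₗᵢ[ℝ] EuclideanSpace ℝ (Fin (2 * M)),
      Measure.map e σ = σ) (a : Fin (2 * M) → ℝ) :
    Summable (fun i : Fin (2 * M) → ℕ =>
      |(∏ j, (a j ^ i j / ((i j).factorial : ℝ) * Real.Gamma ((i j : ℝ) + 1 / 2)))
        / Real.Gamma ((M : ℝ) + ∑ j, (i j : ℝ))|) ∧
    ∫ x, Real.exp (∑ j, a j * x j ^ 2) ∂σ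
      = Real.Gamma M * (Real.pi ^ M)⁻¹ *
        ∑' i : Fin (2 * M) → ℕ,
          (∏ j, (a j ^ i j / ((i j).factorial : ℝ) * Real.Gamma ((i j : ℝ) + 1 / 2)))
            / Real.Gamma ((M : ℝ) + ∑ j, (i j : ℝ)) := by
  have hM0 : (0 : ℝ) < M := by exact_mod_cast hM
  set C : ℝ := Real.Gamma M * (Real.pi ^ M)⁻¹ with hC
  have hCpos : 0 < C := mul_pos (Real.Gamma_pos_of_pos hM0) (by positivity)
  set T : (Fin (2 * M) → ℕ) → ℝ := fun i =>
    (∏ j, (a j ^ i j / ((i j).factorial : ℝ) * Real.Gamma ((i j : ℝ) + 1 / 2)))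
      / Real.Gamma ((M : ℝ) + ∑ j, (i j : ℝ)) with hT
  let c : (Fin (2 * M) → ℕ) → ℝ := fun i => ∏ j, a j ^ i j / ((i j).factorial : ℝ)
  let P : (Fin (2 * M) → ℕ) → EuclideanSpace ℝ (Fin (2 * M)) → ℝ :=
    fun i x => ∏ j, x j ^ (2 * i j)
  have hP0 (i) (x) : 0 ≤ P i x := Finset.prod_nonneg fun j _ => by
    rw [pow_mul]; positivity
  have hP1 (i) : ∀ᵐ x ∂σ, P i x ≤ 1 := hσ_norm.mono fun x hx =>
    Finset.prod_le_one (fun j _ => by rw [pow_mul]; positivity) fun j _ => by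
      rw [pow_mul, ← sq_abs, ← pow_mul]
      exact pow_le_one₀ (abs_nonneg _) (hx ▸ PiLp.norm_apply_le x j)
  have hPc (i) : Continuous (P i) := by fun_prop
  have hP_int (i) : Integrable (P i) σ :=
    Integrable.of_bound (C := 1) (hPc i).aestronglyMeasurable
      ((hP1 i).mono fun x hx => by rwa [Real.norm_of_nonneg (hP0 i x)])
  have hPle (i) : ∫ x, P i x ∂σ ≤ 1 := by
    simpa using integral_mono_ae (hP_int i) (integrable_const 1) (hP1 i)
  have hPnn (i) : 0 ≤ ∫ x, P i x ∂σ := integral_nonneg (hP0 i)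
  have hterm (i) : c i * ∫ x, P i x ∂σ = C * T i := by
    simp only [c, P, hT, integral_prod_even_pow_sphere hM hσ_norm hσ, Finset.prod_mul_distrib]
    ring
  have hexp_norm (b : ℝ) : Summable fun k : ℕ => ‖b ^ k / (k.factorial : ℝ)‖ :=
    NormedSpace.norm_expSeries_div_summable b
  have hc_sum : Summable fun i => ‖c i‖ :=
    (summable_norm_and_hasSum_prod_pi (f := fun j k => a j ^ k / (k.factorial : ℝ))
      fun j => hexp_norm (a j)).1
  have hF_norm (i) : ∫ x, ‖c i * P i x‖ ∂σ = ‖c i‖ * ∫ x, P i x ∂σ := by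
    simp_rw [norm_mul, Real.norm_of_nonneg (hP0 i _), integral_const_mul]
  have hF_sum : Summable fun i => ∫ x, ‖c i * P i x‖ ∂σ := by
    refine hc_sum.of_nonneg_of_le (fun i => integral_nonneg fun x => norm_nonneg _) fun i => ?_
    rw [hF_norm]
    exact mul_le_of_le_one_right (norm_nonneg _) (hPle i)
  have hpoint (x : EuclideanSpace ℝ (Fin (2 * M))) :
      ∑' i, c i * P i x = Real.exp (∑ j, a j * x j ^ 2) := by
    have h := (summable_norm_and_hasSum_prod_pi
      (f := fun j k => (a j * x j ^ 2) ^ k / (k.factorial : ℝ)) fun j => hexp_norm _).2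
    have he (b : ℝ) : ∑' k : ℕ, b ^ k / (k.factorial : ℝ) = Real.exp b := by
      rw [Real.exp_eq_exp_ℝ, NormedSpace.exp_eq_tsum_div]
    simp_rw [he, ← Real.exp_sum] at h
    rw [← h.tsum_eq]
    refine tsum_congr fun i => ?_
    simp only [c, P, ← Finset.prod_mul_distrib]
    refine Finset.prod_congr rfl fun j _ => ?_
    rw [mul_pow, pow_mul]
    ring
  constructor
  · refine (hF_sum.mul_left C⁻¹).congr fun i => ?_
    have h := congrArg abs (hterm i)
    rw [abs_mul, abs_mul, abs_of_pos hCpos, abs_of_nonneg (hPnn i)] at h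
    rw [hF_norm, Real.norm_eq_abs, h, inv_mul_cancel_left₀ hCpos.ne']
  · have h := (hasSum_integral_of_summable_integral_norm
      (fun i => (hP_int i).const_mul (c i)) hF_sum).tsum_eq
    simp_rw [hpoint, integral_const_mul, hterm, tsum_mul_left] at h
    exact h.symm

/-- Series expansion of the ERM1 full risk: with `κ₁,…,κ_{2M}` the singular values of
`A − B`, `1 − C₁(B) = ∫ exp(−½‖(A−B)x‖²) dσ_E(x)
= Γ(M)π^{−M} ∑_i ∏_j ((−Eκ_j²)^{i_j}/i_j!)Γ(i_j+½) / Γ(M+|i|)`,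
the series converging absolutely. -/
theorem full_risk_series_expansion (M : ℕ) (hM : 1 ≤ M) (E : ℝ) (hE : 0 < E)
    (A B : Matrix (Fin (2*M)) (Fin (2*M)) ℝ) (hA : A ∈ KK M) (hB : B ∈ KK M)
    (κ : Fin (2*M) → ℝ) (hκ : ∀ j, 0 ≤ κ j)
    (hsvd : ∃ U V : Matrix (Fin (2*M)) (Fin (2*M)) ℝ,
      Uᵀ * U = 1 ∧ Vᵀ * V = 1 ∧ A - B = U * Matrix.diagonal κ * V)
    (σE : Measure (EuclideanSpace ℝ (Fin (2*M)))) [IsProbabilityMeasure σE]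
    (hsupp : ∀ᵐ x ∂σE, ‖x‖ = Real.sqrt (2*E))
    (hrot : ∀ e : EuclideanSpace ℝ (Fin (2*M)) ≃ₗᵢ[ℝ] EuclideanSpace ℝ (Fin (2*M)),
      Measure.map e σE = σE) :
    Summable (fun i : Fin (2*M) → ℕ =>
      |(∏ j, ((-E * (κ j)^2)^(i j) / ((i j).factorial : ℝ) * Real.Gamma ((i j : ℝ) + 1/2)))
        / Real.Gamma ((M : ℝ) + ∑ j, (i j : ℝ))|) ∧
    1 - (∫ x, (1 - Real.exp (-(1/2) * ‖mv (A - B) x‖^2)) ∂σE)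
      = ∫ x, Real.exp (-(1/2) * ‖mv (A - B) x‖^2) ∂σE ∧
    ∫ x, Real.exp (-(1/2) * ‖mv (A - B) x‖^2) ∂σE
      = Real.Gamma M * (Real.pi ^ M)⁻¹ *
        ∑' i : Fin (2*M) → ℕ,
          (∏ j, ((-E * (κ j)^2)^(i j) / ((i j).factorial : ℝ) * Real.Gamma ((i j : ℝ) + 1/2)))
            / Real.Gamma ((M : ℝ) + ∑ j, (i j : ℝ)) := by
  obtain ⟨U, V, hU, hV, hsvd⟩ := hsvd
  have hR : 0 < Real.sqrt (2 * E) := Real.sqrt_pos.mpr (by linarith)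
  set R := Real.sqrt (2 * E) with hRdef
  have hR2 : R ^ 2 = 2 * E := Real.sq_sqrt (by linarith)
  have hsmul : Measurable fun x : EuclideanSpace ℝ (Fin (2 * M)) => R⁻¹ • x := by fun_prop
  let σ : Measure (EuclideanSpace ℝ (Fin (2 * M))) := Measure.map (fun x => R⁻¹ • x) σE
  have : IsProbabilityMeasure σ := Measure.isProbabilityMeasure_map hsmul.aemeasurable
  have hσ_norm : ∀ᵐ x ∂σ, ‖x‖ = 1 := by
    rw [ae_map_iff hsmul.aemeasurable (measurableSet_eq_fun (by fun_prop) (by fun_prop))]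
    filter_upwards [hsupp] with x hx
    rw [norm_smul, hx, Real.norm_of_nonneg (by positivity), inv_mul_cancel₀ hR.ne']
  have hσ : ∀ e : EuclideanSpace ℝ (Fin (2 * M)) ≃ₗᵢ[ℝ] EuclideanSpace ℝ (Fin (2 * M)),
      Measure.map e σ = σ := fun e => by
    rw [Measure.map_map (by fun_prop) hsmul]
    conv_rhs => rw [show σ = Measure.map (fun x => R⁻¹ • x) σE from rfl, ← hrot e]
    rw [Measure.map_map hsmul (by fun_prop)]
    congr 1
    ext x : 1
    simp
  obtain ⟨h_sum, h_int⟩ := integral_exp_quadratic_sphere_eq_tsum hM hσ_norm hσ fun j => -E * κ j ^ 2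
  have h_int_exp : Integrable (fun x => Real.exp (-(1/2) * ‖mv (A - B) x‖^2)) σE := by
    refine Integrable.of_bound (C := 1) ?_ (.of_forall fun x => ?_)
    · simp only [mv]
      fun_prop
    · rw [Real.norm_of_nonneg (Real.exp_pos _).le, Real.exp_le_one_iff]
      have := sq_nonneg ‖mv (A - B) x‖
      linarith
  refine ⟨h_sum, ?_, ?_⟩
  · rw [integral_sub (integrable_const _) h_int_exp]
    simp
  · rw [← h_int, integral_map hsmul.aemeasurable (by fun_prop)]
    obtain ⟨e, he⟩ := exists_linearIsometryEquiv_eq_mv hV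
    conv_rhs => rw [← hrot e]
    rw [integral_map (by fun_prop) (by fun_prop)]
    refine integral_congr_ae (.of_forall fun x => ?_)
    have hmv : mv (A - B) x = mv U (mv (Matrix.diagonal κ) (e x)) := by
      simp [he, hsvd, mv]
    have hnorm : ‖mv (A - B) x‖ ^ 2 = ∑ j, κ j ^ 2 * (e x) j ^ 2 := by
      rw [hmv, norm_mv_of_orthogonal hU]
      exact norm_sq_mv_diagonal κ (e x)
    simp only [hnorm, PiLp.smul_apply, smul_eq_mul, Finset.mul_sum, mul_pow, inv_pow, hR2]
    congr 1
    refine Finset.sum_congr rfl fun j _ => ?_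
    field_simp
end
end
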